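/- arXiv:math/0208129 — 4 statements merged into one kernel-verified Lean document; each statement's English description precedes it below -/
import Mathlib

section
/- Let a > 0, l ∈ ℕ₀, 0 < ε < 1, n ∈ ℕ, x ∈ ℝⁿ, and let f : ℝⁿ → ℂ be continuous with f(x) = O(|x|^{-a}). Let α ∈ ℂ with 0 < Re α < min(a, n). If f is C^l on a neighborhood of x with every l-th order partial derivative Hölder continuous of index ε there, then for every ε' with 0 < ε' < ε, I^α f is C^{l+⌊Re α⌋} on a neighborhood of x with every (l+⌊Re α⌋)-th order partial derivative Hölder continuous of index ε' there, where ⌊Re α⌋ is the integer part of Re α. -/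
open Complex MeasureTheory Filter Asymptotics Set Metric

/-- `H_n(α) = 2^α π^(n/2) Γ(α/2) / Γ((n-α)/2)`. -/
noncomputable def Hfun (n : ℕ) (α : ℂ) : ℂ :=
  (2 : ℂ) ^ α * (Real.pi : ℂ) ^ ((n : ℂ) / 2) * Complex.Gamma (α / 2) /
    Complex.Gamma (((n : ℂ) - α) / 2)

/-- The Riesz potential `(I^α f)(x) = (1/H_n(α)) ∫_{ℝⁿ} f(y) |x-y|^{α-n} dy`. -/
noncomputable def riesz (n : ℕ) (f : EuclideanSpace ℝ (Fin n) → ℂ) (α : ℂ)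
    (x : EuclideanSpace ℝ (Fin n)) : ℂ :=
  (Hfun n α)⁻¹ * ∫ y : EuclideanSpace ℝ (Fin n), f y * (‖x - y‖ : ℂ) ^ (α - n)

namespace RieszRegularity

open scoped Convolution ContDiff Topology
open Module (finrank)

universe u

section Dilation

variable {E : Type u} [NormedAddCommGroup E] [NormedSpace ℝ E]

/-- The `β`-homogeneous dilation `z ↦ c ^ (-β) κ(c z)`. -/
noncomputable def dilate (β : ℂ) (κ : E → ℂ) (c : ℝ) : E → ℂ :=
  fun z => (c : ℂ) ^ (-β) * κ (c • z)

theorem contDiff_dilate (β : ℂ) {κ : E → ℂ} (hκ : ContDiff ℝ ∞ κ) (c : ℝ) :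
    ContDiff ℝ ∞ (dilate β κ c) :=
  contDiff_const.mul (hκ.comp (contDiff_const_smul c))

theorem dilate_eq_zero (β : ℂ) {κ : E → ℂ} {r : ℝ} (hr : ∀ z, r < ‖z‖ → κ z = 0) {c : ℝ}
    (hc : 0 < c) {z : E} (hz : r / c < ‖z‖) : dilate β κ c z = 0 := by
  rw [dilate, hr, mul_zero]
  rwa [norm_smul, Real.norm_of_nonneg hc.le, mul_comm, ← div_lt_iff₀ hc]

variable [FiniteDimensional ℝ E]

theorem hasCompactSupport_dilate (β : ℂ) {κ : E → ℂ} {r : ℝ} (hr : ∀ z, r < ‖z‖ → κ z = 0)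
    {c : ℝ} (hc : 0 < c) : HasCompactSupport (dilate β κ c) := by
  refine HasCompactSupport.intro (isCompact_closedBall (0 : E) (r / c)) fun z hz => ?_
  exact dilate_eq_zero β hr hc (by simpa using hz)

theorem exists_norm_iteratedFDeriv_dilate_le (β : ℂ) {κ : E → ℂ} (hκ : ContDiff ℝ ∞ κ) {r : ℝ}
    (hr : ∀ z, r < ‖z‖ → κ z = 0) (m : ℕ) :
    ∃ C, 0 ≤ C ∧ ∀ c : ℝ, 0 < c → ∀ z, ‖iteratedFDeriv ℝ m (dilate β κ c) z‖ ≤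
      (closedBall 0 (r / c)).indicator (fun _ => C * c ^ (m - β.re)) z := by
  have hcs : HasCompactSupport κ :=
    HasCompactSupport.intro (isCompact_closedBall (0 : E) r) fun z hz => hr z (by simpa using hz)
  have hts : tsupport κ ⊆ closedBall 0 r :=
    closure_minimal (fun z hz => by
      by_contra h
      exact hz (hr z (by simpa using h))) isClosed_closedBall
  obtain ⟨C, hC⟩ := (hcs.iteratedFDeriv m (𝕜 := ℝ)).exists_bound_of_continuous
    (hκ.continuous_iteratedFDeriv (m := m) (by exact_mod_cast le_top))
  have hC0 : 0 ≤ C := (norm_nonneg _).trans (hC 0)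
  refine ⟨C, hC0, fun c hc z => ?_⟩
  have hd : iteratedFDeriv ℝ m (dilate β κ c) z =
      (c : ℂ) ^ (-β) • (c ^ m • iteratedFDeriv ℝ m κ (c • z)) := by
    have h1 : dilate β κ c = (c : ℂ) ^ (-β) • fun z => κ (c • z) := rfl
    have h2 : ContDiff ℝ m κ := hκ.of_le (by exact_mod_cast le_top)
    have h3 : ContDiffAt ℝ m (fun z => κ (c • z)) z :=
      (h2.comp (contDiff_const_smul c)).contDiffAt
    rw [h1, iteratedFDeriv_const_smul_apply h3,
      iteratedFDeriv_comp_const_smul c h2]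
  rw [hd, norm_smul, norm_smul, Complex.norm_cpow_eq_rpow_re_of_pos hc, norm_pow,
    Real.norm_of_nonneg hc.le, ← mul_assoc, ← Real.rpow_natCast c m, ← Real.rpow_add hc]
  by_cases hz : z ∈ closedBall (0 : E) (r / c)
  · rw [indicator_of_mem hz, mul_comm, neg_re, neg_add_eq_sub]
    gcongr
    exact hC _
  · rw [indicator_of_notMem hz]
    have : iteratedFDeriv ℝ m κ (c • z) = 0 := by
      by_contra h
      have := hts (support_iteratedFDeriv_subset m h)
      rw [mem_closedBall_zero_iff, norm_smul, Real.norm_of_nonneg hc.le, mul_comm,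
        ← le_div_iff₀ hc] at this
      exact hz (by simpa using this)
    simp [this]

end Dilation

section Convolution

variable {E : Type u} [NormedAddCommGroup E] [NormedSpace ℝ E] [FiniteDimensional ℝ E]
  [MeasurableSpace E] [BorelSpace E] {μ : Measure E} [μ.IsAddHaarMeasure]
  {F : Type u} [NormedAddCommGroup F] [NormedSpace ℝ F]

theorem norm_iteratedFDeriv_convolution_le {f : E → F} (hf : Continuous f) (m : ℕ) :
    ∀ {G F' : Type u} [NormedAddCommGroup G] [NormedSpace ℝ G] [NormedAddCommGroup F']
      [NormedSpace ℝ F'] (L : F →L[ℝ] G →L[ℝ] F') (g : E → G), ContDiff ℝ ∞ g →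
      HasCompactSupport g → ∀ x, ‖iteratedFDeriv ℝ m (f ⋆[L, μ] g) x‖ ≤
        ‖L‖ * ∫ t, ‖f t‖ * ‖iteratedFDeriv ℝ m g (x - t)‖ ∂μ := by
  induction m with
  | zero =>
    intro G F' _ _ _ _ L g hg hc x
    simp only [norm_iteratedFDeriv_zero]
    rw [convolution_def, ← integral_const_mul]
    refine norm_integral_le_of_norm_le ?_ (Eventually.of_forall fun t => ?_)
    · exact (hc.norm.convolutionExists_right (ContinuousLinearMap.mul ℝ ℝ)
        hf.norm.locallyIntegrable hg.continuous.norm x).integrable.const_mul _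
    · rw [← mul_assoc]
      exact L.le_opNorm₂ _ _
  | succ m ih =>
    intro G F' _ _ _ _ L g hg hc x
    have hd : fderiv ℝ (f ⋆[L, μ] g) = f ⋆[L.precompR E, μ] fderiv ℝ g := by
      ext1 y
      exact (hc.hasFDerivAt_convolution_right L hf.locallyIntegrable
        (hg.of_le (by simp)) y).fderiv
    rw [← norm_iteratedFDeriv_fderiv, hd]
    refine (ih (L.precompR E) (fderiv ℝ g) (hg.fderiv_right (by simp)) (hc.fderiv ℝ) x).trans ?_
    simp only [norm_iteratedFDeriv_fderiv]
    gcongr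
    exact L.norm_precompR_le E

variable {F' : Type u} [NormedAddCommGroup F'] [NormedSpace ℝ F']

theorem contDiff_convolution_dilate (L : F →L[ℝ] ℂ →L[ℝ] F') (β : ℂ) {κ : E → ℂ}
    (hκ : ContDiff ℝ ∞ κ) {r : ℝ} (hr : ∀ z, r < ‖z‖ → κ z = 0) {c : ℝ} (hc : 0 < c)
    {f : E → F} (hf : Continuous f) : ContDiff ℝ ∞ (f ⋆[L, μ] dilate β κ c) :=
  (hasCompactSupport_dilate β hr hc).contDiff_convolution_right L hf.locallyIntegrable
    (contDiff_dilate β hκ c)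

end Convolution

section Kernel

variable {E : Type} [NormedAddCommGroup E] [NormedSpace ℝ E] [FiniteDimensional ℝ E]
  [MeasurableSpace E] [BorelSpace E] {μ : Measure E} [μ.IsAddHaarMeasure]
  {F : Type} [NormedAddCommGroup F] [NormedSpace ℝ F]
  {F' : Type} [NormedAddCommGroup F'] [NormedSpace ℝ F']

theorem exists_integral_norm_mul_iteratedFDeriv_dilate_le (μ : Measure E) [μ.IsAddHaarMeasure]
    {G : Type} [NormedAddCommGroup G] (β : ℂ) {κ : E → ℂ} (hκ : ContDiff ℝ ∞ κ) {r : ℝ}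
    (hr : ∀ z, r < ‖z‖ → κ z = 0) (m : ℕ) :
    ∃ C, 0 ≤ C ∧ ∀ c : ℝ, 0 < c → ∀ f : E → G, Continuous f → ∀ x,
      ∫ t, ‖f t‖ * ‖iteratedFDeriv ℝ m (dilate β κ c) (x - t)‖ ∂μ ≤
        C * (c ^ (m - β.re) * ∫ t in closedBall x (r / c), ‖f t‖ ∂μ) := by
  obtain ⟨C, hC0, hC⟩ := exists_norm_iteratedFDeriv_dilate_le β hκ hr m
  refine ⟨C, hC0, fun c hc f hf x => ?_⟩
  rw [← mul_assoc, ← integral_const_mul, ← integral_indicator measurableSet_closedBall]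
  refine integral_mono_of_nonneg (Eventually.of_forall fun t => by positivity) ?_
    (Eventually.of_forall fun t => ?_)
  · rw [integrable_indicator_iff measurableSet_closedBall]
    exact (hf.norm.continuousOn.integrableOn_compact (isCompact_closedBall _ _)).const_mul _
  · have h := hC c hc (x - t)
    by_cases ht : t ∈ closedBall x (r / c)
    · have ht' : x - t ∈ closedBall (0 : E) (r / c) := by
        simpa [dist_eq_norm, norm_sub_rev] using ht
      rw [indicator_of_mem ht'] at h
      simp only [indicator_of_mem ht]
      rw [mul_comm]
      gcongr
    · have ht' : x - t ∉ closedBall (0 : E) (r / c) := by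
        simpa [dist_eq_norm, norm_sub_rev] using ht
      rw [indicator_of_notMem ht'] at h
      simp only [indicator_of_notMem ht]
      exact (mul_nonpos_of_nonneg_of_nonpos (norm_nonneg _) h)

theorem exists_norm_iteratedFDeriv_convolution_dilate_le (L : F →L[ℝ] ℂ →L[ℝ] F') (β : ℂ)
    {κ : E → ℂ} (hκ : ContDiff ℝ ∞ κ) {r : ℝ} (hr : ∀ z, r < ‖z‖ → κ z = 0) (m : ℕ) :
    ∃ C, 0 ≤ C ∧ ∀ c : ℝ, 0 < c → ∀ f : E → F, Continuous f → ∀ x,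
      ‖iteratedFDeriv ℝ m (f ⋆[L, μ] dilate β κ c) x‖ ≤
        C * (c ^ (m - β.re) * ∫ t in closedBall x (r / c), ‖f t‖ ∂μ) := by
  obtain ⟨C, hC0, hC⟩ := exists_integral_norm_mul_iteratedFDeriv_dilate_le μ (G := F) β hκ hr m
  refine ⟨‖L‖ * C, by positivity, fun c hc f hf x => ?_⟩
  refine (norm_iteratedFDeriv_convolution_le hf m L _ (contDiff_dilate β hκ c)
    (hasCompactSupport_dilate β hr hc) x).trans ?_
  rw [mul_assoc]
  gcongr
  exact hC c hc f hf x

theorem norm_iteratedFDeriv_succ_convolution_sub_const (L : F →L[ℝ] ℂ →L[ℝ] F') {g : E → ℂ}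
    (hg : Continuous g) (hc : HasCompactSupport g) {f : E → F} (hf : Continuous f) (v : F) (m : ℕ)
    (x : E) :
    ‖iteratedFDeriv ℝ (m + 1) ((fun t => f t - v) ⋆[L, μ] g) x‖ =
      ‖iteratedFDeriv ℝ (m + 1) (f ⋆[L, μ] g) x‖ := by
  have h : ((fun t => f t - v) ⋆[L, μ] g) = fun y => (f ⋆[L, μ] g) y - ∫ t, L v (g t) ∂μ := by
    ext1 y
    rw [convolution_def, convolution_def, ← integral_sub_left_eq_self (fun t => L v (g t)) μ y,
      ← integral_sub]
    · simp
    · exact (hc.convolutionExists_right L hf.locallyIntegrable hg y).integrable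
    · exact (hc.convolutionExists_right L (continuous_const (y := v)).locallyIntegrable hg
        y).integrable
  rw [← norm_iteratedFDeriv_fderiv, ← norm_iteratedFDeriv_fderiv, h]
  congr 2
  ext1 y
  exact fderiv_sub_const _

theorem rpow_mul_setIntegral_norm_le (μ : Measure E) [μ.IsAddHaarMeasure]
    {G : Type} [NormedAddCommGroup G] (e : ℝ) {r : ℝ}
    (hr0 : 0 ≤ r) {c : ℝ} (hc : 0 < c) {f : E → G} {S : ℝ} {x : E}
    (hS : ∀ t ∈ closedBall x (r / c), ‖f t‖ ≤ S) :
    c ^ e * ∫ t in closedBall x (r / c), ‖f t‖ ∂μ ≤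
      r ^ finrank ℝ E * μ.real (ball 0 1) * S * c ^ (e - finrank ℝ E) := by
  have hI : ∫ t in closedBall x (r / c), ‖f t‖ ∂μ ≤ S * μ.real (closedBall x (r / c)) := by
    refine (Real.le_norm_self _).trans ?_
    exact norm_setIntegral_le_of_norm_le_const measure_closedBall_lt_top
      (fun t ht => by simpa using hS t ht)
  rw [Measure.addHaar_real_closedBall μ x (by positivity)] at hI
  calc _ ≤ c ^ e * (S * ((r / c) ^ finrank ℝ E * μ.real (ball 0 1))) := by gcongr
    _ = _ := by
      rw [Real.rpow_sub hc _ (finrank ℝ E : ℝ), Real.rpow_natCast, div_pow]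
      ring

/-- Uniform bound for the dyadic pieces of a Riesz potential of a bounded function. -/
theorem exists_norm_iteratedFDeriv_le_of_bounded (L : F →L[ℝ] ℂ →L[ℝ] F') (β : ℂ)
    {κ : E → ℂ} (hκ : ContDiff ℝ ∞ κ) {r : ℝ} (hr0 : 0 ≤ r) (hr : ∀ z, r < ‖z‖ → κ z = 0) (m : ℕ) :
    ∃ C, 0 ≤ C ∧ ∀ c : ℝ, 0 < c → ∀ (f : E → F) (S : ℝ), Continuous f → (∀ x, ‖f x‖ ≤ S) → ∀ x,
      ‖iteratedFDeriv ℝ m (f ⋆[L, μ] dilate β κ c) x‖ ≤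
        C * S * c ^ (m - (β.re + finrank ℝ E)) := by
  obtain ⟨C, hC0, hC⟩ := exists_norm_iteratedFDeriv_convolution_dilate_le (μ := μ) L β hκ hr m
  refine ⟨C * (r ^ finrank ℝ E * μ.real (ball 0 1)), by positivity, fun c hc f S hf hS x => ?_⟩
  refine (hC c hc f hf x).trans ?_
  refine (mul_le_mul_of_nonneg_left
    (rpow_mul_setIntegral_norm_le μ _ hr0 hc fun t _ => hS t) hC0).trans_eq ?_
  rw [← sub_sub]
  ring

/-- Uniform bound for the derivatives of the dyadic pieces of a Riesz potential of a Hölder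
continuous function. -/
theorem exists_norm_iteratedFDeriv_le_of_holder (L : F →L[ℝ] ℂ →L[ℝ] F') (β : ℂ)
    {κ : E → ℂ} (hκ : ContDiff ℝ ∞ κ) {r : ℝ} (hr0 : 0 < r) (hr : ∀ z, r < ‖z‖ → κ z = 0) (m : ℕ)
    {ε : ℝ} (hε : 0 < ε) :
    ∃ C, 0 ≤ C ∧ ∀ c : ℝ, 0 < c → ∀ (f : E → F) (M : ℝ), 0 ≤ M → Continuous f →
      (∀ x y, ‖f x - f y‖ ≤ M * ‖x - y‖ ^ ε) → ∀ x,
      ‖iteratedFDeriv ℝ (m + 1) (f ⋆[L, μ] dilate β κ c) x‖ ≤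
        C * M * c ^ ((m + 1 : ℕ) - (β.re + finrank ℝ E) - ε) := by
  obtain ⟨C, hC0, hC⟩ :=
    exists_norm_iteratedFDeriv_convolution_dilate_le (μ := μ) L β hκ hr (m + 1)
  refine ⟨C * (r ^ ε * (r ^ finrank ℝ E * μ.real (ball 0 1))), by positivity,
    fun c hc f M hM hf hH x => ?_⟩
  rw [← norm_iteratedFDeriv_succ_convolution_sub_const L (contDiff_dilate β hκ c).continuous
    (hasCompactSupport_dilate β hr hc) hf (f x) m x]
  have hS : ∀ t ∈ closedBall x (r / c), ‖f t - f x‖ ≤ M * (r / c) ^ ε := fun t ht => by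
    refine (hH t x).trans ?_
    gcongr
    simpa [dist_eq_norm] using ht
  refine (hC c hc (fun t => f t - f x) (hf.sub continuous_const) x).trans ?_
  refine (mul_le_mul_of_nonneg_left
    (rpow_mul_setIntegral_norm_le μ _ hr0.le hc hS) hC0).trans_eq ?_
  rw [← sub_sub, Real.rpow_sub hc _ ε, Real.div_rpow hr0.le hc.le]
  ring

end Kernel

section LocalPart

theorem summable_two_pow_rpow {e : ℝ} (he : e < 0) : Summable fun j : ℕ => ((2 : ℝ) ^ j) ^ e := by
  have h : ∀ j : ℕ, ((2 : ℝ) ^ j) ^ e = ((2 : ℝ) ^ e) ^ j := fun j => by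
    rw [← Real.rpow_natCast, ← Real.rpow_natCast, ← Real.rpow_mul zero_le_two,
      ← Real.rpow_mul zero_le_two, mul_comm]
  simp only [h]
  exact summable_geometric_of_lt_one (by positivity)
    (Real.rpow_lt_one_of_one_lt_of_neg one_lt_two he)

variable {E : Type} [NormedAddCommGroup E] [NormedSpace ℝ E] [MeasurableSpace E] (μ : Measure E)
  {F : Type} [NormedAddCommGroup F] [NormedSpace ℝ F]
  {F' : Type} [NormedAddCommGroup F'] [NormedSpace ℝ F']

/-- The sum of the convolutions of `f` with the dyadic dilates of `κ` at scales at most `1`. -/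
noncomputable def localPart (L : F →L[ℝ] ℂ →L[ℝ] F') (β : ℂ) (κ : E → ℂ) (f : E → F) (x : E) : F' :=
  ∑' j : ℕ, (f ⋆[L, μ] dilate β κ (2 ^ j)) x

variable {μ}

theorem localPart_congr (L : F →L[ℝ] ℂ →L[ℝ] F') (β : ℂ) {κ : E → ℂ} {r : ℝ} (hr0 : 0 < r)
    (hr : ∀ z, r < ‖z‖ → κ z = 0) {f g : E → F} {x : E} {ρ : ℝ} (h : EqOn f g (ball x (ρ + r))) :
    EqOn (localPart μ L β κ f) (localPart μ L β κ g) (ball x ρ) := by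
  intro y hy
  unfold localPart
  congr 1
  ext1 j
  rw [convolution_def, convolution_def]
  congr 1
  ext1 t
  by_cases ht : t ∈ ball x (ρ + r)
  · rw [h ht]
  · rw [dilate_eq_zero β hr (c := 2 ^ j) (by positivity)]
    · simp
    · have h1 : ρ + r ≤ dist t x := by simpa using ht
      have h2 : dist y x < ρ := hy
      have h3 := dist_triangle t y x
      have h4 : r / 2 ^ j ≤ r := div_le_self hr0.le (one_le_pow₀ one_le_two)
      rw [← dist_eq_norm, dist_comm]
      linarith

variable [FiniteDimensional ℝ E] [BorelSpace E] [μ.IsAddHaarMeasure]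
  (L : F →L[ℝ] ℂ →L[ℝ] F') {β : ℂ} {κ : E → ℂ} {r : ℝ}

theorem exists_summable_norm_convolution_le (hκ : ContDiff ℝ ∞ κ) (hr0 : 0 < r)
    (hr : ∀ z, r < ‖z‖ → κ z = 0) (hs : 0 < β.re + finrank ℝ E) {f : E → F}
    (hf : Continuous f) {S : ℝ} (hS : ∀ x, ‖f x‖ ≤ S) :
    ∃ u : ℕ → ℝ, Summable u ∧ ∀ j x, ‖(f ⋆[L, μ] dilate β κ (2 ^ j)) x‖ ≤ u j := by
  obtain ⟨C, hC0, hC⟩ := exists_norm_iteratedFDeriv_le_of_bounded (μ := μ) L β hκ hr0.le hr 0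
  refine ⟨fun j => C * S * ((2 : ℝ) ^ j) ^ (((0 : ℕ) : ℝ) - (β.re + finrank ℝ E)),
    (summable_two_pow_rpow (by rw [Nat.cast_zero, zero_sub]; exact neg_neg_of_pos hs)).mul_left _,
    fun j x => ?_⟩
  simpa using hC (2 ^ j) (by positivity) f S hf hS x

variable [CompleteSpace F']

theorem summable_convolution_dilate (hκ : ContDiff ℝ ∞ κ) (hr0 : 0 < r)
    (hr : ∀ z, r < ‖z‖ → κ z = 0) (hs : 0 < β.re + finrank ℝ E) {f : E → F}
    (hf : Continuous f) {S : ℝ} (hS : ∀ x, ‖f x‖ ≤ S) (x : E) :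
    Summable fun j : ℕ => (f ⋆[L, μ] dilate β κ (2 ^ j)) x := by
  obtain ⟨u, hu, h⟩ := exists_summable_norm_convolution_le (μ := μ) L hκ hr0 hr hs hf hS
  exact .of_norm_bounded hu fun j => h j x

theorem exists_norm_iteratedFDeriv_localPart_le (hκ : ContDiff ℝ ∞ κ) (hr0 : 0 < r)
    (hr : ∀ z, r < ‖z‖ → κ z = 0) {k : ℕ} (hs : 0 < β.re + finrank ℝ E)
    (hk : k ≤ β.re + finrank ℝ E) {δ : ℝ} (hδ : 0 < δ) :
    ∃ C, 0 ≤ C ∧ ∀ (f : E → F) (S M : ℝ), 0 ≤ M → Continuous f → (∀ x, ‖f x‖ ≤ S) →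
      (∀ x y, ‖f x - f y‖ ≤ M * ‖x - y‖ ^ δ) → ContDiff ℝ k (localPart μ L β κ f) ∧
      ∀ x, ‖iteratedFDeriv ℝ k (localPart μ L β κ f) x‖ ≤ C * (S + M) := by
  have key : ∀ m : ℕ, ∃ u : ℕ → ℝ, (∀ j, 0 ≤ u j) ∧ (m ≤ k → Summable u) ∧
      ∀ j (f : E → F) (S M : ℝ), 0 ≤ M → Continuous f → (∀ x, ‖f x‖ ≤ S) →
      (∀ x y, ‖f x - f y‖ ≤ M * ‖x - y‖ ^ δ) → ∀ x,
      ‖iteratedFDeriv ℝ m (f ⋆[L, μ] dilate β κ (2 ^ j)) x‖ ≤ (S + M) * u j := by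
    intro m
    cases m with
    | zero =>
      obtain ⟨C, hC0, hC⟩ := exists_norm_iteratedFDeriv_le_of_bounded (μ := μ) L β hκ hr0.le hr 0
      refine ⟨fun j => C * ((2 : ℝ) ^ j) ^ (((0 : ℕ) : ℝ) - (β.re + finrank ℝ E)),
        fun j => by positivity,
        fun _ => (summable_two_pow_rpow (by
          rw [Nat.cast_zero, zero_sub]; exact neg_neg_of_pos hs)).mul_left _,
        fun j f S M hM hf hS hH x => (hC (2 ^ j) (by positivity) f S hf hS x).trans ?_⟩
      rw [mul_comm C, mul_assoc]
      gcongr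
      linarith
    | succ m =>
      obtain ⟨C, hC0, hC⟩ := exists_norm_iteratedFDeriv_le_of_holder (μ := μ) L β hκ hr0 hr m hδ
      refine ⟨fun j => C * ((2 : ℝ) ^ j) ^ (((m + 1 : ℕ) : ℝ) - (β.re + finrank ℝ E) - δ),
        fun j => by positivity,
        fun hm => (summable_two_pow_rpow ?_).mul_left _,
        fun j f S M hM hf hS hH x => (hC (2 ^ j) (by positivity) f M hM hf hH x).trans ?_⟩
      · have : ((m + 1 : ℕ) : ℝ) ≤ k := by exact_mod_cast hm
        linarith
      · rw [mul_comm C, mul_assoc]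
        gcongr
        linarith [(norm_nonneg _).trans (hS x)]
  choose u hu0 hu hb using key
  refine ⟨∑' j, u k j, tsum_nonneg (hu0 k), fun f S M hM hf hS hH => ?_⟩
  have hcd : ∀ j : ℕ, ContDiff ℝ k (f ⋆[L, μ] dilate β κ (2 ^ j)) := fun j =>
    (contDiff_convolution_dilate L β hκ hr (by positivity) hf).of_le (by exact_mod_cast le_top)
  have hsum : ∀ m : ℕ, (m : ℕ∞) ≤ (k : ℕ∞) → Summable fun j => (S + M) * u m j := fun m hm =>
    (hu m (by exact_mod_cast hm)).mul_left _
  have hbd : ∀ (m : ℕ) (j : ℕ) (x : E), (m : ℕ∞) ≤ (k : ℕ∞) →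
      ‖iteratedFDeriv ℝ m (f ⋆[L, μ] dilate β κ (2 ^ j)) x‖ ≤ (S + M) * u m j := fun m j x _ =>
    hb m j f S M hM hf hS hH x
  refine ⟨contDiff_tsum hcd hsum hbd, fun x => ?_⟩
  have := iteratedFDeriv_tsum_apply hcd hsum hbd le_rfl x
  unfold localPart
  rw [this, mul_comm, ← tsum_mul_left]
  exact tsum_of_norm_bounded (hsum k le_rfl).hasSum fun j => hbd k j x le_rfl

theorem localPart_sub_translate (hκ : ContDiff ℝ ∞ κ) (hr0 : 0 < r)
    (hr : ∀ z, r < ‖z‖ → κ z = 0) (hs : 0 < β.re + finrank ℝ E) {f : E → F} (hf : Continuous f)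
    {S : ℝ} (hS : ∀ x, ‖f x‖ ≤ S) (w y : E) :
    localPart μ L β κ (fun t => f (t + w) - f t) y =
      localPart μ L β κ f (y + w) - localPart μ L β κ f y := by
  unfold localPart
  rw [← Summable.tsum_sub (summable_convolution_dilate L hκ hr0 hr hs hf hS _)
    (summable_convolution_dilate L hκ hr0 hr hs hf hS _)]
  congr 1
  ext1 j
  have hc := hasCompactSupport_dilate β hr (c := 2 ^ j) (by positivity)
  have hg := (contDiff_dilate β hκ (2 ^ j)).continuous
  have hfw : Continuous fun t => f (t + w) := hf.comp (continuous_add_const w)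
  rw [convolution_def, convolution_def, convolution_def,
    ← integral_add_right_eq_self (fun t => L (f t) (dilate β κ (2 ^ j) (y + w - t))) w,
    ← integral_sub]
  · simp
  · simpa using (hc.convolutionExists_right L hfw.locallyIntegrable hg y).integrable
  · exact (hc.convolutionExists_right L hf.locallyIntegrable hg y).integrable

theorem contDiff_localPart_and_holder (hκ : ContDiff ℝ ∞ κ) (hr0 : 0 < r)
    (hr : ∀ z, r < ‖z‖ → κ z = 0) {k : ℕ} (hs : 0 < β.re + finrank ℝ E)
    (hk : k ≤ β.re + finrank ℝ E) {ε ε' : ℝ} (hε' : 0 < ε') (hε : ε' < ε) {f : E → F} {S M : ℝ}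
    (hM : 0 ≤ M) (hf : Continuous f) (hS : ∀ x, ‖f x‖ ≤ S)
    (hH : ∀ x y, ‖f x - f y‖ ≤ M * ‖x - y‖ ^ ε) :
    ContDiff ℝ k (localPart μ L β κ f) ∧
      ∃ M', ∀ x y, ‖iteratedFDeriv ℝ k (localPart μ L β κ f) x -
        iteratedFDeriv ℝ k (localPart μ L β κ f) y‖ ≤ M' * ‖x - y‖ ^ ε' := by
  obtain ⟨C₁, -, hC₁⟩ := exists_norm_iteratedFDeriv_localPart_le (μ := μ) L hκ hr0 hr hs hk
    (hε'.trans hε)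
  have hcd := (hC₁ f S M hM hf hS hH).1
  obtain ⟨C, hC0, hC⟩ := exists_norm_iteratedFDeriv_localPart_le (μ := μ) L hκ hr0 hr hs hk
    (sub_pos.2 hε)
  have hS0 : 0 ≤ S := (norm_nonneg _).trans (hS 0)
  have hH' : ∀ x y, ‖f x - f y‖ ≤ (M + 2 * S) * ‖x - y‖ ^ ε' := fun x y => by
    have h2 : ‖f x - f y‖ ≤ 2 * S := (norm_sub_le _ _).trans (by linarith [hS x, hS y])
    rcases le_total ‖x - y‖ 1 with h | h
    · calc _ ≤ M * ‖x - y‖ ^ ε := hH x y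
        _ ≤ M * ‖x - y‖ ^ ε' := by
          gcongr M * ?_
          exact Real.rpow_le_rpow_of_exponent_ge' (norm_nonneg _) h hε'.le hε.le
        _ ≤ _ := by gcongr; linarith
    · calc _ ≤ (2 * S) * 1 := by simpa using h2
        _ ≤ (M + 2 * S) * ‖x - y‖ ^ ε' := by
          gcongr
          · linarith
          · exact Real.one_le_rpow h hε'.le
  refine ⟨hcd, C * (M + 2 * S + 2 * M), fun x y => ?_⟩
  set w := x - y with hw
  have hfw : Continuous fun t => f (t + w) := hf.comp (continuous_add_const w)
  have hS' : ∀ t, ‖f (t + w) - f t‖ ≤ (M + 2 * S) * ‖w‖ ^ ε' := fun t => by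
    simpa using hH' (t + w) t
  have hsplit : ∀ a b : ℝ, 0 ≤ a → 0 ≤ b → min (a ^ ε) (b ^ ε) ≤ a ^ ε' * b ^ (ε - ε') := by
    intro a b ha hb
    have he : ∀ c : ℝ, 0 ≤ c → c ^ ε = c ^ ε' * c ^ (ε - ε') := fun c hc => by
      rw [← Real.rpow_add_of_nonneg hc hε'.le (sub_nonneg.2 hε.le)]
      ring_nf
    rcases le_total a b with h | h
    · refine (min_le_left _ _).trans ?_
      rw [he a ha]
      gcongr
    · refine (min_le_right _ _).trans ?_
      rw [he b hb]
      gcongr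
  have hM' : ∀ s t, ‖(f (s + w) - f s) - (f (t + w) - f t)‖ ≤
      (2 * M * ‖w‖ ^ ε') * ‖s - t‖ ^ (ε - ε') := fun s t => by
    have h1 : ‖(f (s + w) - f s) - (f (t + w) - f t)‖ ≤ 2 * M * ‖w‖ ^ ε := by
      refine (norm_sub_le _ _).trans ?_
      have a1 := hH (s + w) s
      have a2 := hH (t + w) t
      rw [add_sub_cancel_left] at a1 a2
      linarith
    have h2 : ‖(f (s + w) - f s) - (f (t + w) - f t)‖ ≤ 2 * M * ‖s - t‖ ^ ε := by
      rw [sub_sub_sub_comm]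
      refine (norm_sub_le _ _).trans ?_
      have a1 := hH (s + w) (t + w)
      have a2 := hH s t
      rw [add_sub_add_right_eq_sub] at a1
      linarith
    calc _ ≤ 2 * M * min (‖w‖ ^ ε) (‖s - t‖ ^ ε) := by
          rw [mul_min_of_nonneg _ _ (by positivity)]
          exact le_min h1 h2
      _ ≤ 2 * M * (‖w‖ ^ ε' * ‖s - t‖ ^ (ε - ε')) := by
          gcongr
          exact hsplit _ _ (norm_nonneg _) (norm_nonneg _)
      _ = _ := by ring
  have hfin := (hC (fun t => f (t + w) - f t) _ _ (by positivity) (hfw.sub hf) hS' hM').2 y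
  have heq : localPart μ L β κ (fun t => f (t + w) - f t) =
      (fun z => localPart μ L β κ f (z + w)) - localPart μ L β κ f :=
    funext fun z => localPart_sub_translate L hκ hr0 hr hs hf hS w z
  have hcdw : ContDiff ℝ k fun z => localPart μ L β κ f (z + w) :=
    hcd.comp (contDiff_id.add contDiff_const)
  rw [heq, iteratedFDeriv_sub_apply hcdw.contDiffAt hcd.contDiffAt,
    iteratedFDeriv_comp_add_right, hw, add_sub_cancel] at hfin
  exact hfin.trans_eq (by ring)

theorem hasFDerivAt_localPart (hκ : ContDiff ℝ ∞ κ) (hr0 : 0 < r)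
    (hr : ∀ z, r < ‖z‖ → κ z = 0) (hs : 0 < β.re + finrank ℝ E) {f : E → F} (hf : ContDiff ℝ 1 f)
    (hc : HasCompactSupport f) (x : E) :
    HasFDerivAt (localPart μ L β κ f)
      (localPart μ (L.precompL E) β κ (fderiv ℝ f) x) x := by
  have hf' : Continuous (fderiv ℝ f) := hf.continuous_fderiv one_ne_zero
  obtain ⟨S, hS⟩ := hc.exists_bound_of_continuous hf.continuous
  obtain ⟨S', hS'⟩ := (hc.fderiv ℝ).exists_bound_of_continuous hf'
  obtain ⟨u, hu, hub⟩ := exists_summable_norm_convolution_le (μ := μ) (L.precompL E) hκ hr0 hr hs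
    hf' hS'
  exact hasFDerivAt_tsum hu (fun j y => hc.hasFDerivAt_convolution_left L hf
    (contDiff_dilate β hκ (2 ^ j)).continuous.locallyIntegrable y) hub
    (summable_convolution_dilate L hκ hr0 hr hs hf.continuous hS x) x

end LocalPart

section Cutoff

variable {E : Type} [NormedAddCommGroup E] [NormedSpace ℝ E]
  {F : Type} [NormedAddCommGroup F] [NormedSpace ℝ F]

theorem norm_iteratedFDeriv_fderiv_sub (f : E → F) (m : ℕ) (x y : E) :
    ‖iteratedFDeriv ℝ m (fderiv ℝ f) x - iteratedFDeriv ℝ m (fderiv ℝ f) y‖ =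
      ‖iteratedFDeriv ℝ (m + 1) f x - iteratedFDeriv ℝ (m + 1) f y‖ := by
  rw [iteratedFDeriv_succ_eq_comp_right, iteratedFDeriv_succ_eq_comp_right, ← dist_eq_norm,
    ← dist_eq_norm]
  exact (LinearIsometryEquiv.dist_map _ _ _).symm

theorem eqOn_iteratedFDeriv {f g : E → F} {U : Set E} (hU : IsOpen U) (h : EqOn f g U) (m : ℕ) :
    EqOn (iteratedFDeriv ℝ m f) (iteratedFDeriv ℝ m g) U := fun _ hy =>
  ((h.eventuallyEq_of_mem (hU.mem_nhds hy)).iteratedFDeriv ℝ m).eq_of_nhds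

variable [FiniteDimensional ℝ E] {x : E} (χ : ContDiffBump x)

theorem hasCompactSupport_bump_smul (f : E → F) : HasCompactSupport fun y => χ y • f y :=
  χ.hasCompactSupport.smul_right

theorem eqOn_bump_smul (f : E → F) : EqOn (fun y => χ y • f y) f (ball x χ.rIn) := fun y hy => by
  simp only [χ.one_of_mem_closedBall (ball_subset_closedBall hy), one_smul]

theorem contDiff_bump_smul {R : ℝ} (hR : χ.rOut < R) {f : E → F} {m : ℕ}
    (hf : ContDiffOn ℝ m f (ball x R)) : ContDiff ℝ m fun y => χ y • f y := by
  rw [contDiff_iff_contDiffAt]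
  intro y
  by_cases hy : y ∈ ball x R
  · exact χ.contDiffAt.smul (hf.contDiffAt (isOpen_ball.mem_nhds hy))
  · have h : (fun y => χ y • f y) =ᶠ[𝓝 y] fun _ => 0 := by
      have hy' : y ∈ (closedBall x χ.rOut)ᶜ := fun h => hy (closedBall_subset_ball hR h)
      filter_upwards [isClosed_closedBall.isOpen_compl.mem_nhds hy'] with z hz
      rw [χ.zero_of_le_dist (le_of_lt (by simpa using hz)), zero_smul]
    exact contDiffAt_const.congr_of_eventuallyEq h

theorem exists_holder_bump_smul {R : ℝ} (hR : χ.rOut < R) {f : E → F} (hf : Continuous f)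
    {ε M : ℝ} (hε0 : 0 < ε) (hε1 : ε < 1)
    (hH : ∀ y ∈ ball x R, ∀ z ∈ ball x R, ‖f y - f z‖ ≤ M * ‖y - z‖ ^ ε) :
    ∃ M', 0 ≤ M' ∧ ∀ y z, ‖χ y • f y - χ z • f z‖ ≤ M' * ‖y - z‖ ^ ε := by
  obtain ⟨Λ, hΛ⟩ := (χ.contDiff (n := 1)).lipschitzWith_of_hasCompactSupport
    χ.hasCompactSupport one_ne_zero
  obtain ⟨B, hB⟩ := (isCompact_closedBall x χ.rOut).exists_bound_of_continuousOn hf.continuousOn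
  have hχ : ∀ y z, ‖χ y - χ z‖ ≤ max (Λ : ℝ) 1 * ‖y - z‖ ^ ε := fun y z => by
    rcases le_total ‖y - z‖ 1 with h | h
    · calc _ ≤ Λ * ‖y - z‖ := hΛ.norm_sub_le y z
        _ ≤ max (Λ : ℝ) 1 * ‖y - z‖ ^ (1 : ℝ) := by
          rw [Real.rpow_one]
          gcongr
          exact le_max_left _ _
        _ ≤ _ := by
          gcongr ?_ * ?_
          exact Real.rpow_le_rpow_of_exponent_ge' (norm_nonneg _) h hε0.le hε1.le
    · calc ‖χ y - χ z‖ ≤ 1 * 1 := by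
            rw [Real.norm_eq_abs, abs_le]
            constructor <;> linarith [χ.nonneg (x := y), χ.nonneg (x := z), χ.le_one (x := y),
              χ.le_one (x := z)]
        _ ≤ _ := by
          gcongr
          · exact le_max_right _ _
          · exact Real.one_le_rpow h hε0.le
  have hB0 : 0 ≤ B := (norm_nonneg _).trans (hB x (mem_closedBall_self χ.rOut_pos.le))
  have key : ∀ y, ∀ z ∈ closedBall x χ.rOut,
      ‖χ y • f y - χ z • f z‖ ≤ (|M| + max (Λ : ℝ) 1 * B) * ‖y - z‖ ^ ε := fun y z hz => by
    have h1 : ‖χ y • (f y - f z)‖ ≤ |M| * ‖y - z‖ ^ ε := by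
      by_cases hy : y ∈ ball x R
      · rw [norm_smul, Real.norm_of_nonneg χ.nonneg]
        calc _ ≤ 1 * (M * ‖y - z‖ ^ ε) := by
              gcongr
              · exact χ.le_one
              · exact hH y hy z (closedBall_subset_ball hR hz)
          _ ≤ _ := by
              rw [one_mul]
              gcongr
              exact le_abs_self M
      · rw [χ.zero_of_le_dist (hR.le.trans (by simpa using hy)), zero_smul, norm_zero]
        positivity
    have h2 : ‖(χ y - χ z) • f z‖ ≤ max (Λ : ℝ) 1 * ‖y - z‖ ^ ε * B := by
      rw [norm_smul]
      gcongr
      · exact hχ y z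
      · exact hB z hz
    calc _ = ‖χ y • (f y - f z) + (χ y - χ z) • f z‖ := by
          congr 1
          module
      _ ≤ _ := (norm_add_le _ _).trans (by linarith)
  refine ⟨|M| + max (Λ : ℝ) 1 * B, by positivity, fun y z => ?_⟩
  by_cases hz : z ∈ closedBall x χ.rOut
  · exact key y z hz
  by_cases hy : y ∈ closedBall x χ.rOut
  · rw [norm_sub_rev, norm_sub_rev y]
    exact key z y hy
  · have hz0 : χ z = 0 := χ.zero_of_le_dist (le_of_lt (by simpa using hz))
    have hy0 : χ y = 0 := χ.zero_of_le_dist (le_of_lt (by simpa using hy))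
    rw [hz0, hy0, zero_smul, zero_smul, sub_zero, norm_zero]
    positivity

end Cutoff

section LocalRegularity

variable {E : Type} [NormedAddCommGroup E] [NormedSpace ℝ E] [FiniteDimensional ℝ E]
  [MeasurableSpace E] [BorelSpace E] {μ : Measure E} [μ.IsAddHaarMeasure]

/-- Local regularity of the local part of a Riesz potential. -/
theorem contDiffOn_localPart_and_holder {β : ℂ} {κ : E → ℂ} (hκ : ContDiff ℝ ∞ κ) {r : ℝ}
    (hr0 : 0 < r) (hr : ∀ z, r < ‖z‖ → κ z = 0) (hs : 0 < β.re + finrank ℝ E) {k : ℕ}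
    (hk : k ≤ β.re + finrank ℝ E) {ε ε' : ℝ} (hε' : 0 < ε') (hε : ε' < ε) (hε1 : ε < 1) (x : E)
    (M : ℝ) (l : ℕ) :
    ∀ {F F' : Type} [NormedAddCommGroup F] [NormedSpace ℝ F] [NormedAddCommGroup F']
      [NormedSpace ℝ F'] [CompleteSpace F'] (L : F →L[ℝ] ℂ →L[ℝ] F') {f : E → F},
      Continuous f → ContDiffOn ℝ l f (ball x ((l + 3) * r)) →
      (∀ y ∈ ball x ((l + 3) * r), ∀ z ∈ ball x ((l + 3) * r),
        ‖iteratedFDeriv ℝ l f y - iteratedFDeriv ℝ l f z‖ ≤ M * ‖y - z‖ ^ ε) →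
      ContDiffOn ℝ (l + k : ℕ) (localPart μ L β κ f) (ball x r) ∧
        ∃ M', ∀ y ∈ ball x r, ∀ z ∈ ball x r,
          ‖iteratedFDeriv ℝ (l + k) (localPart μ L β κ f) y -
            iteratedFDeriv ℝ (l + k) (localPart μ L β κ f) z‖ ≤ M' * ‖y - z‖ ^ ε' := by
  have hball : ∀ {ρ : ℝ}, 2 * r ≤ ρ → ball x (r + r) ⊆ ball x ρ := fun h =>
    ball_subset_ball (by linarith)
  induction l with
  | zero =>
    intro F F' _ _ _ _ _ L f hf _ hH
    let χ : ContDiffBump x := ⟨2 * r, 5 / 2 * r, by linarith, by linarith⟩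
    have hR : χ.rOut < ((0 : ℕ) + 3) * r := by
      change 5 / 2 * r < _
      push_cast
      linarith
    have hH0 : ∀ y ∈ ball x (((0 : ℕ) + 3) * r), ∀ z ∈ ball x (((0 : ℕ) + 3) * r),
        ‖f y - f z‖ ≤ M * ‖y - z‖ ^ ε := fun y hy z hz => by
      have h := hH y hy z hz
      rwa [iteratedFDeriv_zero_eq_comp, Function.comp_apply, Function.comp_apply, ← map_sub,
        LinearIsometryEquiv.norm_map] at h
    obtain ⟨M₁, hM₁, hH₁⟩ := exists_holder_bump_smul χ hR hf (hε'.trans hε) hε1 hH0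
    have hcont : Continuous fun y => χ y • f y := χ.continuous.smul hf
    obtain ⟨S, hS⟩ := (hasCompactSupport_bump_smul χ f).exists_bound_of_continuous hcont
    obtain ⟨hcd, M₂, hM₂⟩ :=
      contDiff_localPart_and_holder (μ := μ) L hκ hr0 hr hs hk hε' hε hM₁ hcont hS hH₁
    have heq := localPart_congr (μ := μ) L β hr0 hr (ρ := r)
      ((eqOn_bump_smul χ f).symm.mono (hball le_rfl))
    rw [zero_add]
    refine ⟨hcd.contDiffOn.congr heq, M₂, fun y hy z hz => ?_⟩
    rw [eqOn_iteratedFDeriv isOpen_ball heq k hy, eqOn_iteratedFDeriv isOpen_ball heq k hz]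
    exact hM₂ y z
  | succ l ih =>
    intro F F' _ _ _ _ _ L f hf hfl hH
    let χ : ContDiffBump x := ⟨(l + 3) * r, (l + 7 / 2) * r, by positivity, by gcongr; norm_num⟩
    have hR : χ.rOut < ((l + 1 : ℕ) + 3) * r := by
      change (l + 7 / 2) * r < _
      gcongr ?_ * r
      push_cast
      linarith
    have hcd : ContDiff ℝ (l + 1 : ℕ) fun y => χ y • f y := contDiff_bump_smul χ hR hfl
    have hcs := hasCompactSupport_bump_smul χ f
    have heqf : EqOn (fun y => χ y • f y) f (ball x ((l + 3) * r)) := eqOn_bump_smul χ f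
    have hsub : ball x ((l + 3) * r) ⊆ ball x (((l + 1 : ℕ) + 3) * r) :=
      ball_subset_ball (by gcongr; simp)
    have hcd1 : ContDiff ℝ 1 fun y => χ y • f y := hcd.of_le (by exact_mod_cast Nat.le_add_left 1 l)
    obtain ⟨h1, M₁, hM₁⟩ := ih (L.precompL E) (hcd1.continuous_fderiv one_ne_zero)
      (hcd.fderiv_right (m := l) (by norm_cast)).contDiffOn fun y hy z hz => by
        rw [norm_iteratedFDeriv_fderiv_sub, eqOn_iteratedFDeriv isOpen_ball heqf _ hy,
          eqOn_iteratedFDeriv isOpen_ball heqf _ hz]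
        exact hH y (hsub hy) z (hsub hz)
    have hd := hasFDerivAt_localPart (μ := μ) L hκ hr0 hr hs hcd1 hcs
    have hfd : fderiv ℝ (localPart μ L β κ fun y => χ y • f y) =
        localPart μ (L.precompL E) β κ (fderiv ℝ fun y => χ y • f y) :=
      funext fun y => (hd y).fderiv
    have heq := localPart_congr (μ := μ) L β hr0 hr (ρ := r)
      (heqf.symm.mono (hball (by gcongr; linarith)))
    rw [Nat.add_right_comm]
    refine ⟨ContDiffOn.congr ?_ heq, M₁, fun y hy z hz => ?_⟩
    · rw [Nat.cast_add_one, contDiffOn_succ_iff_fderiv_of_isOpen isOpen_ball, hfd]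
      exact ⟨fun y _ => (hd y).differentiableAt.differentiableWithinAt, by simp, h1⟩
    · rw [eqOn_iteratedFDeriv isOpen_ball heq _ hy, eqOn_iteratedFDeriv isOpen_ball heq _ hz,
        ← norm_iteratedFDeriv_fderiv_sub, hfd]
      exact hM₁ y hy z hz

end LocalRegularity

section FarPart

variable {E : Type} [NormedAddCommGroup E] [NormedSpace ℝ E] [FiniteDimensional ℝ E]

theorem exists_holder_iteratedFDeriv_of_contDiff {F : Type} [NormedAddCommGroup F]
    [NormedSpace ℝ F] {g : E → F} (hg : ContDiff ℝ ∞ g) (x : E) {r : ℝ} (hr : 0 ≤ r) (N : ℕ) {ε : ℝ}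
    (hε0 : 0 < ε) (hε1 : ε < 1) :
    ∃ M, ∀ y ∈ ball x r, ∀ z ∈ ball x r,
      ‖iteratedFDeriv ℝ N g y - iteratedFDeriv ℝ N g z‖ ≤ M * ‖y - z‖ ^ ε := by
  have hcd : ContDiff ℝ 1 (iteratedFDeriv ℝ N g) :=
    hg.iteratedFDeriv_right (by exact_mod_cast le_top)
  obtain ⟨C, hC⟩ := (isCompact_closedBall x r).exists_bound_of_continuousOn
    (hcd.continuous_fderiv one_ne_zero).continuousOn
  have hC0 : 0 ≤ C := (norm_nonneg _).trans (hC x (mem_closedBall_self hr))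
  refine ⟨C * (2 * r) ^ (1 - ε), fun y hy z hz => ?_⟩
  have h := (convex_ball x r).norm_image_sub_le_of_norm_fderiv_le
    (fun w _ => hcd.differentiable one_ne_zero w) (fun w hw => hC w (ball_subset_closedBall hw))
    hz hy
  have hd : ‖y - z‖ ≤ 2 * r := by
    rw [← dist_eq_norm]
    linarith [dist_triangle_right y z x, mem_ball.1 hy, mem_ball.1 hz]
  calc _ ≤ C * ‖y - z‖ := h
    _ = C * (‖y - z‖ ^ (1 - ε) * ‖y - z‖ ^ ε) := by
      rw [← Real.rpow_add_of_nonneg (norm_nonneg _) (by linarith) hε0.le, sub_add_cancel,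
        Real.rpow_one]
    _ ≤ C * ((2 * r) ^ (1 - ε) * ‖y - z‖ ^ ε) := by
      gcongr
    _ = _ := by ring

variable [MeasurableSpace E] [BorelSpace E]
  {F : Type} [NormedAddCommGroup F]

/-- Growth of the integrals over balls of a function which decays polynomially. -/
theorem exists_setIntegral_norm_le_of_decay (μ : Measure E) [μ.IsAddHaarMeasure] {f : E → F}
    (hf : Continuous f) {a b C₀ : ℝ} (hdecay : ∀ y, ‖f y‖ ≤ C₀ * (1 + ‖y‖) ^ (-a)) (hb0 : 0 < b)
    (hba : b < a) (hbd : b ≤ finrank ℝ E) :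
    ∃ C, 0 ≤ C ∧ ∀ x R, 0 ≤ R →
      ∫ y in closedBall x R, ‖f y‖ ∂μ ≤ C * (1 + R) ^ (finrank ℝ E - b) := by
  set d : ℝ := (finrank ℝ E : ℝ)
  have hint : Integrable (fun y : E => (1 + ‖y‖) ^ (-(d + (a - b)))) μ :=
    integrable_one_add_norm (by linarith)
  have hC₀ : 0 ≤ C₀ := by simpa using (norm_nonneg _).trans (hdecay 0)
  set I := ∫ y : E, (1 + ‖y‖) ^ (-(d + (a - b))) ∂μ
  have hI : 0 ≤ I := integral_nonneg fun y => by positivity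
  refine ⟨C₀ * (μ.real (ball 0 1) + I), by positivity, fun x R hR => ?_⟩
  have hpt : ∀ y, ‖f y‖ ≤
      C₀ * ((1 + R) ^ (-b) + (1 + ‖y‖) ^ (-(d + (a - b))) * (1 + R) ^ (d - b)) := fun y => by
    refine (hdecay y).trans (mul_le_mul_of_nonneg_left ?_ hC₀)
    have hy1 : 1 ≤ 1 + ‖y‖ := by simp
    rcases le_total (1 + R) (1 + ‖y‖) with h | h
    · calc (1 + ‖y‖) ^ (-a) ≤ (1 + ‖y‖) ^ (-b) :=
            Real.rpow_le_rpow_of_exponent_le hy1 (by linarith)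
        _ ≤ (1 + R) ^ (-b) := Real.rpow_le_rpow_of_nonpos (by positivity) h (by linarith)
        _ ≤ _ := le_add_of_nonneg_right (by positivity)
    · calc (1 + ‖y‖) ^ (-a) = (1 + ‖y‖) ^ (-(d + (a - b))) * (1 + ‖y‖) ^ (d - b) := by
            rw [← Real.rpow_add (by positivity)]
            ring_nf
        _ ≤ (1 + ‖y‖) ^ (-(d + (a - b))) * (1 + R) ^ (d - b) := by
            gcongr
        _ ≤ _ := le_add_of_nonneg_left (by positivity)
  have hfin : IsFiniteMeasure (μ.restrict (closedBall x R)) :=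
    ⟨by rw [Measure.restrict_apply_univ]; exact measure_closedBall_lt_top⟩
  calc ∫ y in closedBall x R, ‖f y‖ ∂μ
    _ ≤ ∫ y in closedBall x R,
        C₀ * ((1 + R) ^ (-b) + (1 + ‖y‖) ^ (-(d + (a - b))) * (1 + R) ^ (d - b)) ∂μ :=
      integral_mono (hf.norm.continuousOn.integrableOn_compact (isCompact_closedBall _ _))
        (((integrable_const _).add (hint.integrableOn.mul_const _)).const_mul _) hpt
    _ = C₀ * ((R ^ finrank ℝ E * μ.real (ball 0 1)) * (1 + R) ^ (-b) +
        (∫ y in closedBall x R, (1 + ‖y‖) ^ (-(d + (a - b))) ∂μ) * (1 + R) ^ (d - b)) := by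
      rw [integral_const_mul, integral_add (integrable_const _) (hint.integrableOn.mul_const _),
        integral_mul_const, setIntegral_const, Measure.addHaar_real_closedBall μ x hR, smul_eq_mul]
    _ ≤ C₀ * (((1 + R) ^ d * μ.real (ball 0 1)) * (1 + R) ^ (-b) + I * (1 + R) ^ (d - b)) := by
      gcongr
      · rw [Real.rpow_natCast]
        gcongr
        linarith
      · exact setIntegral_le_integral hint (Eventually.of_forall fun y => by positivity)
    _ = _ := by
      rw [sub_eq_add_neg d b, Real.rpow_add (by positivity)]
      ring

theorem exists_summable_rpow_mul_setIntegral_norm_le (μ : Measure E) [μ.IsAddHaarMeasure]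
    {f : E → F} (hf : Continuous f) {a b C₀ : ℝ} (hdecay : ∀ y, ‖f y‖ ≤ C₀ * (1 + ‖y‖) ^ (-a))
    (hb0 : 0 < b) (hba : b < a) (hbd : b ≤ finrank ℝ E) {r : ℝ} (hr0 : 0 ≤ r) {e : ℝ}
    (he : finrank ℝ E < e + b) :
    ∃ u : ℕ → ℝ, Summable u ∧ ∀ j x, ((2 ^ (j + 1))⁻¹ : ℝ) ^ e *
      ∫ t in closedBall x (r / (2 ^ (j + 1))⁻¹), ‖f t‖ ∂μ ≤ u j := by
  obtain ⟨C, hC0, hC⟩ := exists_setIntegral_norm_le_of_decay μ hf hdecay hb0 hba hbd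
  refine ⟨fun j => C * (1 + r) ^ (finrank ℝ E - b) *
    ((2 : ℝ) ^ (j + 1)) ^ (-(e + b - finrank ℝ E)),
    ((summable_nat_add_iff 1).2 (summable_two_pow_rpow (by linarith))).mul_left _, fun j x => ?_⟩
  have h1 : (1 : ℝ) ≤ 2 ^ (j + 1) := one_le_pow₀ one_le_two
  rw [div_inv_eq_mul]
  calc _ ≤ ((2 ^ (j + 1))⁻¹ : ℝ) ^ e *
        (C * ((1 + r) * 2 ^ (j + 1)) ^ (finrank ℝ E - b)) := by
        gcongr
        refine (hC x _ (by positivity)).trans ?_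
        gcongr
        linarith
    _ = _ := by
        rw [Real.mul_rpow (by positivity) (by positivity), Real.inv_rpow (by positivity),
          ← Real.rpow_neg (by positivity)]
        have : (-(e + b - finrank ℝ E)) = -e + (finrank ℝ E - b) := by ring
        simp only [this]
        rw [Real.rpow_add (by positivity)]
        ring

variable [NormedSpace ℝ F] {F' : Type} [NormedAddCommGroup F'] [NormedSpace ℝ F']

/-- The sum of the convolutions of `f` with the dyadic dilates of `κ` at scales exceeding `1`. -/
noncomputable def farPart (μ : Measure E) (L : F →L[ℝ] ℂ →L[ℝ] F') (β : ℂ) (κ : E → ℂ) (f : E → F)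
    (x : E) : F' :=
  ∑' j : ℕ, (f ⋆[L, μ] dilate β κ (2 ^ (j + 1))⁻¹) x

theorem contDiff_farPart [CompleteSpace F'] {μ : Measure E} [μ.IsAddHaarMeasure]
    (L : F →L[ℝ] ℂ →L[ℝ] F') {β : ℂ} {κ : E → ℂ} (hκ : ContDiff ℝ ∞ κ) {r : ℝ} (hr0 : 0 ≤ r)
    (hr : ∀ z, r < ‖z‖ → κ z = 0) {f : E → F} (hf : Continuous f) {a b C₀ : ℝ}
    (hdecay : ∀ y, ‖f y‖ ≤ C₀ * (1 + ‖y‖) ^ (-a)) (hb0 : 0 < b) (hba : b < a)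
    (hbd : b ≤ finrank ℝ E) (hb : β.re + finrank ℝ E < b) :
    ContDiff ℝ ∞ (farPart μ L β κ f) := by
  have key : ∀ m : ℕ, ∃ u : ℕ → ℝ, Summable u ∧
      ∀ j x, ‖iteratedFDeriv ℝ m (f ⋆[L, μ] dilate β κ (2 ^ (j + 1))⁻¹) x‖ ≤ u j := by
    intro m
    obtain ⟨C, hC0, hC⟩ := exists_norm_iteratedFDeriv_convolution_dilate_le (μ := μ) L β hκ hr m
    obtain ⟨u, hu, hub⟩ := exists_summable_rpow_mul_setIntegral_norm_le μ hf hdecay hb0 hba hbd hr0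
      (e := m - β.re) (by linarith [(Nat.cast_nonneg m : (0 : ℝ) ≤ m)])
    exact ⟨fun j => C * u j, hu.mul_left C, fun j x => (hC _ (by positivity) f hf x).trans
      (mul_le_mul_of_nonneg_left (hub j x) hC0)⟩
  choose u hu hub using key
  exact contDiff_tsum (fun j => contDiff_convolution_dilate L β hκ hr (by positivity) hf)
    (fun m _ => hu m) fun m j x _ => hub m j x

end FarPart

section Decomposition

theorem hasSum_sub_succ_of_eventually_const {g : ℕ → ℂ} {v : ℂ} {N : ℕ} (h : ∀ j ≥ N, g j = v) :
    HasSum (fun j => g j - g (j + 1)) (g 0 - v) := by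
  rw [← h N le_rfl, ← Finset.sum_range_sub']
  refine hasSum_sum_of_ne_finset_zero fun j hj => ?_
  have hj' : N ≤ j := by simpa using hj
  rw [h j hj', h (j + 1) (by lia), sub_self]

variable {E : Type} [NormedAddCommGroup E] [InnerProductSpace ℝ E] [FiniteDimensional ℝ E]

/-- The kernel `‖z‖ ^ β` restricted smoothly to an annulus. -/
noncomputable def annularKernel (φ : ContDiffBump (0 : E)) (β : ℂ) (z : E) : ℂ :=
  ((φ z : ℂ) - φ ((2 : ℝ) • z)) * (‖z‖ : ℂ) ^ β

theorem contDiff_annularKernel (φ : ContDiffBump (0 : E)) (β : ℂ) :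
    ContDiff ℝ ∞ (annularKernel φ β) := by
  rw [contDiff_iff_contDiffAt]
  intro z
  by_cases hz : z = 0
  · have h : annularKernel φ β =ᶠ[𝓝 z] fun _ => 0 := by
      have hcont : Tendsto (fun w : E => (2 : ℝ) • w) (𝓝 0) (𝓝 0) := by
        simpa using (continuous_const_smul (2 : ℝ) : Continuous fun w : E => (2 : ℝ) • w).tendsto 0
      rw [hz]
      filter_upwards [φ.eventuallyEq_one, hcont.eventually φ.eventuallyEq_one] with w h1 h2
      rw [annularKernel, h1, h2]
      simp
    exact contDiffAt_const.congr_of_eventuallyEq h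
  · have hK : ContDiffAt ℝ ∞ (fun w : E => (‖w‖ : ℂ) ^ β) z := by
      have h1 : ContDiffAt ℝ ∞ (fun w : E => Complex.exp ((Real.log ‖w‖ : ℝ) * β)) z :=
        ((ofRealCLM.contDiff.contDiffAt.comp z
          ((contDiffAt_id.norm ℝ hz).log (norm_ne_zero_iff.2 hz))).mul contDiffAt_const).cexp
      refine h1.congr_of_eventuallyEq ?_
      filter_upwards [isOpen_ne.mem_nhds hz] with w hw
      rw [cpow_def_of_ne_zero (by exact_mod_cast norm_ne_zero_iff.2 hw),
        ofReal_log (norm_nonneg _)]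
    refine ContDiffAt.mul (ContDiffAt.sub ?_ ?_) hK
    · exact ofRealCLM.contDiff.contDiffAt.comp z φ.contDiffAt
    · exact ofRealCLM.contDiff.contDiffAt.comp z
        (φ.contDiffAt.comp z (contDiff_const_smul (2 : ℝ)).contDiffAt)

theorem annularKernel_eq_zero (φ : ContDiffBump (0 : E)) (β : ℂ) (z : E) (hz : φ.rOut < ‖z‖) :
    annularKernel φ β z = 0 := by
  have h1 : φ z = 0 := φ.zero_of_le_dist (by simpa using hz.le)
  have h2 : φ ((2 : ℝ) • z) = 0 := φ.zero_of_le_dist (by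
    rw [dist_zero_right, norm_smul, Real.norm_two]
    linarith [norm_nonneg z])
  rw [annularKernel, h1, h2]
  simp

theorem dilate_annularKernel (φ : ContDiffBump (0 : E)) (β : ℂ) {c : ℝ} (hc : 0 < c) (z : E) :
    dilate β (annularKernel φ β) c z = (φ (c • z) - φ ((2 * c) • z)) * (‖z‖ : ℂ) ^ β := by
  have hc' : (c : ℂ) ≠ 0 := by exact_mod_cast hc.ne'
  rw [dilate, annularKernel, smul_smul, norm_smul, Real.norm_of_nonneg hc.le, ofReal_mul,
    mul_cpow_ofReal_nonneg hc.le (norm_nonneg _), mul_left_comm, cpow_neg,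
    inv_mul_cancel_left₀ (by simp [cpow_eq_zero_iff, hc'])]

theorem hasSum_dilate_annularKernel (φ : ContDiffBump (0 : E)) {β : ℂ} (hβ : β ≠ 0) (z : E) :
    HasSum (fun j : ℤ => dilate β (annularKernel φ β) (2 ^ j) z) ((‖z‖ : ℂ) ^ β) := by
  by_cases hz : z = 0
  · subst hz
    have h0 : ((‖(0 : E)‖ : ℝ) : ℂ) ^ β = 0 := by simp [hβ]
    have : ∀ j : ℤ, dilate β (annularKernel φ β) (2 ^ j) (0 : E) = 0 := fun j => by
      rw [dilate_annularKernel φ β (by positivity), h0, mul_zero]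
    simpa only [this, h0] using hasSum_zero
  have hz0 : 0 < ‖z‖ := norm_pos_iff.2 hz
  obtain ⟨N₁, hN₁⟩ := pow_unbounded_of_one_lt (φ.rOut / ‖z‖) one_lt_two
  obtain ⟨N₂, hN₂⟩ := pow_unbounded_of_one_lt (‖z‖ / φ.rIn) one_lt_two
  have h1 : ∀ j ≥ N₁, (φ ((2 ^ j : ℝ) • z) : ℂ) = 0 := fun j hj => by
    rw [φ.zero_of_le_dist, ofReal_zero]
    rw [dist_zero_right, norm_smul, Real.norm_of_nonneg (by positivity), ← div_le_iff₀ hz0]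
    exact hN₁.le.trans (pow_le_pow_right₀ one_le_two hj)
  have h2 : ∀ j ≥ N₂, (φ (((2 : ℝ) ^ j)⁻¹ • z) : ℂ) = 1 := fun j hj => by
    rw [φ.one_of_mem_closedBall, ofReal_one]
    rw [mem_closedBall_zero_iff, norm_smul, Real.norm_of_nonneg (by positivity),
      inv_mul_le_iff₀ (by positivity), ← div_le_iff₀ φ.rIn_pos]
    exact hN₂.le.trans (pow_le_pow_right₀ one_le_two hj)
  have near := (hasSum_sub_succ_of_eventually_const h1).mul_right ((‖z‖ : ℂ) ^ β)
  have far := (hasSum_sub_succ_of_eventually_const h2).neg.mul_right ((‖z‖ : ℂ) ^ β)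
  convert HasSum.of_nat_of_neg_add_one (f := fun j : ℤ => dilate β (annularKernel φ β) (2 ^ j) z)
    (near.congr_fun ?_) (far.congr_fun ?_) using 1
  · simp
    ring
  · intro j
    rw [zpow_natCast, dilate_annularKernel φ β (by positivity), pow_succ']
  · intro j
    have h : (2 : ℝ) * (2 ^ (j + 1))⁻¹ = (2 ^ j)⁻¹ := by
      rw [pow_succ']
      field_simp
    rw [zpow_neg, ← Nat.cast_succ, zpow_natCast, dilate_annularKernel φ β (by positivity), h,
      neg_sub]

variable [MeasurableSpace E] [BorelSpace E]

theorem integral_mul_norm_cpow_eq (μ : Measure E) [μ.IsAddHaarMeasure] (φ : ContDiffBump (0 : E))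
    {β : ℂ} (hβ : β ≠ 0) (hs : 0 < β.re + finrank ℝ E) {f : E → ℂ} (hf : Continuous f)
    {a b C₀ S : ℝ} (hS : ∀ y, ‖f y‖ ≤ S)
    (hdecay : ∀ y, ‖f y‖ ≤ C₀ * (1 + ‖y‖) ^ (-a)) (hb0 : 0 < b) (hba : b < a)
    (hbd : b ≤ finrank ℝ E) (hb : β.re + finrank ℝ E < b) (x : E) :
    ∫ y, f y * (‖x - y‖ : ℂ) ^ β ∂μ =
      localPart μ (ContinuousLinearMap.mul ℝ ℂ) β (annularKernel φ β) f x +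
        farPart μ (ContinuousLinearMap.mul ℝ ℂ) β (annularKernel φ β) f x := by
  have hκ := contDiff_annularKernel φ β
  have hr := annularKernel_eq_zero φ β
  have hr0 := φ.rOut_pos
  set κ := annularKernel φ β
  obtain ⟨C, hC0, hC⟩ := exists_integral_norm_mul_iteratedFDeriv_dilate_le μ (G := ℂ) β hκ hr 0
  simp only [norm_iteratedFDeriv_zero] at hC
  obtain ⟨u, hu, hub⟩ := exists_summable_rpow_mul_setIntegral_norm_le μ hf hdecay hb0 hba hbd hr0.le
    (e := (0 : ℕ) - β.re) (by push_cast; linarith)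
  have hint : ∀ c : ℝ, 0 < c → Integrable (fun y => f y * dilate β κ c (x - y)) μ := fun c hc =>
    ((hasCompactSupport_dilate β hr hc).convolutionExists_right (ContinuousLinearMap.mul ℝ ℂ)
      hf.locallyIntegrable (contDiff_dilate β hκ c).continuous x).integrable
  have hnear : Summable fun j : ℕ => ∫ y, ‖f y * dilate β κ (2 ^ (j : ℤ)) (x - y)‖ ∂μ := by
    refine .of_nonneg_of_le (fun j => integral_nonneg fun y => norm_nonneg _) (fun j => ?_)
      ((summable_two_pow_rpow (e := (0 : ℕ) - β.re - finrank ℝ E) (by push_cast; linarith)).mul_left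
        (C * (φ.rOut ^ finrank ℝ E * μ.real (ball 0 1) * S)))
    simp only [norm_mul, zpow_natCast]
    refine (hC (2 ^ j) (by positivity) f hf x).trans ?_
    rw [mul_assoc C]
    exact mul_le_mul_of_nonneg_left
      (rpow_mul_setIntegral_norm_le μ _ hr0.le (by positivity) fun t _ => hS t) hC0
  have hfar : Summable fun j : ℕ =>
      ∫ y, ‖f y * dilate β κ (2 ^ (-((j : ℤ) + 1))) (x - y)‖ ∂μ := by
    refine .of_nonneg_of_le (fun j => integral_nonneg fun y => norm_nonneg _) (fun j => ?_)
      (hu.mul_left C)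
    simp only [norm_mul, zpow_neg, ← Nat.cast_succ, zpow_natCast]
    exact (hC _ (by positivity) f hf x).trans (mul_le_mul_of_nonneg_left (hub j x) hC0)
  have hsum := hasSum_integral_of_summable_integral_norm
    (F := fun (j : ℤ) y => f y * dilate β κ (2 ^ j) (x - y)) (fun j => hint _ (by positivity))
    (hnear.of_nat_of_neg_add_one hfar)
  have htsum : ∀ y, ∑' j : ℤ, f y * dilate β κ (2 ^ j) (x - y) = f y * (‖x - y‖ : ℂ) ^ β := fun y =>
    ((hasSum_dilate_annularKernel φ hβ (x - y)).mul_left (f y)).tsum_eq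
  simp only [htsum] at hsum
  rw [← hsum.tsum_eq, tsum_of_nat_of_neg_add_one]
  · simp only [zpow_neg, ← Nat.cast_succ, zpow_natCast]
    rfl
  · exact hnear.of_norm_bounded fun j => norm_integral_le_integral_norm _
  · exact hfar.of_norm_bounded fun j => norm_integral_le_integral_norm _

end Decomposition

section Potential

variable {E : Type} [NormedAddCommGroup E] [InnerProductSpace ℝ E] [FiniteDimensional ℝ E]

theorem exists_norm_le_of_isBigO_cocompact {f : E → ℂ} (hf : Continuous f) {a : ℝ} (ha : 0 < a)
    (hO : f =O[cocompact E] fun y => ‖y‖ ^ (-a)) :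
    ∃ C, 0 ≤ C ∧ ∀ y, ‖f y‖ ≤ C * (1 + ‖y‖) ^ (-a) := by
  obtain ⟨C, hC0, hC⟩ := hO.exists_nonneg
  obtain ⟨K, hK, hKs⟩ := mem_cocompact.1
    (hC.bound.and ((tendsto_norm_cocompact_atTop (E := E)).eventually_ge_atTop 1))
  have hcont : Continuous fun y : E => ‖f y‖ * (1 + ‖y‖) ^ a :=
    hf.norm.mul ((continuous_const.add continuous_norm).rpow_const fun y => Or.inr ha.le)
  obtain ⟨B, hB⟩ := hK.exists_bound_of_continuousOn hcont.continuousOn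
  refine ⟨max B (C * 2 ^ a), le_max_of_le_right (by positivity), fun y => ?_⟩
  rw [Real.rpow_neg (by positivity), ← div_eq_mul_inv, le_div_iff₀ (by positivity)]
  by_cases hy : y ∈ K
  · exact (Real.le_norm_self _).trans ((hB y hy).trans (le_max_left _ _))
  · obtain ⟨h1, h2⟩ : ‖f y‖ ≤ C * ‖‖y‖ ^ (-a)‖ ∧ 1 ≤ ‖y‖ := hKs hy
    rw [Real.norm_of_nonneg (by positivity)] at h1
    calc _ ≤ C * ‖y‖ ^ (-a) * (2 * ‖y‖) ^ a := by
          gcongr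
          linarith
      _ = C * 2 ^ a * (‖y‖ ^ (-a) * ‖y‖ ^ a) := by
          rw [Real.mul_rpow zero_le_two (norm_nonneg y)]
          ring
      _ = C * 2 ^ a := by
          rw [← Real.rpow_add (by linarith), neg_add_cancel, Real.rpow_zero, mul_one]
      _ ≤ _ := le_max_right _ _

variable [MeasurableSpace E] [BorelSpace E]

/-- Local regularity of the convolution of a decaying function with a locally integrable power
of the norm. -/
theorem contDiffOn_integral_mul_norm_cpow_and_holder (μ : Measure E) [μ.IsAddHaarMeasure] {β : ℂ}
    (hβ : β.re < 0) {k : ℕ} (hs : 0 < β.re + finrank ℝ E) (hk : k ≤ β.re + finrank ℝ E) {a : ℝ}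
    (ha : β.re + finrank ℝ E < a) {f : E → ℂ} (hf : Continuous f)
    (hO : f =O[cocompact E] fun y => ‖y‖ ^ (-a)) {ε ε' : ℝ} (hε' : 0 < ε') (hε : ε' < ε)
    (hε1 : ε < 1) (x : E) (M : ℝ) (l : ℕ) {r : ℝ} (hr : 0 < r)
    (hfl : ContDiffOn ℝ l f (ball x ((l + 3) * r)))
    (hH : ∀ y ∈ ball x ((l + 3) * r), ∀ z ∈ ball x ((l + 3) * r),
      ‖iteratedFDeriv ℝ l f y - iteratedFDeriv ℝ l f z‖ ≤ M * ‖y - z‖ ^ ε) (c : ℂ) :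
    ContDiffOn ℝ (l + k : ℕ) (fun z => c * ∫ y, f y * (‖z - y‖ : ℂ) ^ β ∂μ) (ball x r) ∧
      ∃ M', ∀ y ∈ ball x r, ∀ z ∈ ball x r,
        ‖iteratedFDeriv ℝ (l + k) (fun z => c * ∫ y, f y * (‖z - y‖ : ℂ) ^ β ∂μ) y -
          iteratedFDeriv ℝ (l + k) (fun z => c * ∫ y, f y * (‖z - y‖ : ℂ) ^ β ∂μ) z‖ ≤
            M' * ‖y - z‖ ^ ε' := by
  have ha0 : 0 < a := hs.trans ha
  obtain ⟨C₀, hC₀, hdecay⟩ := exists_norm_le_of_isBigO_cocompact hf ha0 hO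
  have hS : ∀ y, ‖f y‖ ≤ C₀ := fun y => (hdecay y).trans
    (mul_le_of_le_one_right hC₀ (Real.rpow_le_one_of_one_le_of_nonpos (by simp) (by linarith)))
  obtain ⟨b, hb, hb'⟩ := exists_between (lt_min ha (by linarith : β.re + finrank ℝ E < finrank ℝ E))
  have hba : b < a := hb'.trans_le (min_le_left _ _)
  have hbd : b ≤ finrank ℝ E := (hb'.trans_le (min_le_right _ _)).le
  have hb0 : 0 < b := hs.trans hb
  let φ : ContDiffBump (0 : E) := ⟨r / 2, r, by positivity, by linarith⟩
  have hκ := contDiff_annularKernel φ β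
  have hκr : ∀ z, r < ‖z‖ → annularKernel φ β z = 0 := annularKernel_eq_zero φ β
  have hβ0 : β ≠ 0 := fun h => by simp [h] at hβ
  set A := localPart μ (ContinuousLinearMap.mul ℝ ℂ) β (annularKernel φ β) f
  set B := farPart μ (ContinuousLinearMap.mul ℝ ℂ) β (annularKernel φ β) f
  have hAB : (fun z => c * ∫ y, f y * (‖z - y‖ : ℂ) ^ β ∂μ) = c • (A + B) := funext fun z => by
    rw [integral_mul_norm_cpow_eq μ φ hβ0 hs hf hS hdecay hb0 hba hbd hb z]
    rfl
  have hBcd : ContDiff ℝ ∞ B := contDiff_farPart _ hκ hr.le hκr hf hdecay hb0 hba hbd hb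
  have hBcd' : ContDiff ℝ (l + k : ℕ) B := hBcd.of_le (by exact_mod_cast le_top)
  obtain ⟨hAcd, M₁, hM₁⟩ := contDiffOn_localPart_and_holder (μ := μ) hκ hr hκr hs hk hε' hε hε1 x
    M l (ContinuousLinearMap.mul ℝ ℂ) hf hfl hH
  obtain ⟨M₂, hM₂⟩ := exists_holder_iteratedFDeriv_of_contDiff hBcd x hr.le (l + k) hε'
    (hε.trans hε1)
  have hd : ∀ y ∈ ball x r, iteratedFDeriv ℝ (l + k) (c • (A + B)) y =
      c • (iteratedFDeriv ℝ (l + k) A y + iteratedFDeriv ℝ (l + k) B y) := fun y hy => by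
    have hAy := hAcd.contDiffAt (isOpen_ball.mem_nhds hy)
    have hAB' : ContDiffAt ℝ (l + k : ℕ) (A + B) y := hAy.add hBcd'.contDiffAt
    rw [iteratedFDeriv_const_smul_apply hAB', iteratedFDeriv_add_apply hAy hBcd'.contDiffAt]
  rw [hAB]
  refine ⟨(hAcd.add hBcd'.contDiffOn).const_smul c, ‖c‖ * (M₁ + M₂), fun y hy z hz => ?_⟩
  rw [hd y hy, hd z hz, ← smul_sub, add_sub_add_comm, norm_smul, mul_assoc, add_mul]
  gcongr
  exact (norm_add_le _ _).trans (add_le_add (hM₁ y hy z hz) (hM₂ y hy z hz))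

end Potential

end RieszRegularity

theorem stmt_11 (a : ℝ) (ha : 0 < a) (l : ℕ) (ε : ℝ) (hε0 : 0 < ε) (hε1 : ε < 1)
    (n : ℕ) (hn : 0 < n) (x : EuclideanSpace ℝ (Fin n))
    (f : EuclideanSpace ℝ (Fin n) → ℂ) (hfc : Continuous f)
    (hdecay : f =O[cocompact (EuclideanSpace ℝ (Fin n))] fun y => ‖y‖ ^ (-a))
    (α : ℂ) (hα0 : 0 < α.re) (hα1 : α.re < min a n)
    (O : Set (EuclideanSpace ℝ (Fin n))) (hO : IsOpen O) (hxO : x ∈ O)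
    (hCl : ContDiffOn ℝ l f O)
    (M : ℝ) (hHolder : ∀ x₁ ∈ O, ∀ x₂ ∈ O,
      ‖iteratedFDerivWithin ℝ l f O x₁ - iteratedFDerivWithin ℝ l f O x₂‖ ≤ M * ‖x₁ - x₂‖ ^ ε) :
    ∀ ε' : ℝ, 0 < ε' → ε' < ε →
      ∃ V : Set (EuclideanSpace ℝ (Fin n)), IsOpen V ∧ x ∈ V ∧
        ContDiffOn ℝ (l + ⌊α.re⌋.toNat) (riesz n f α) V ∧
        ∃ M' : ℝ, ∀ x₁ ∈ V, ∀ x₂ ∈ V,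
          ‖iteratedFDerivWithin ℝ (l + ⌊α.re⌋.toNat) (riesz n f α) V x₁ -
            iteratedFDerivWithin ℝ (l + ⌊α.re⌋.toNat) (riesz n f α) V x₂‖ ≤
              M' * ‖x₁ - x₂‖ ^ ε' := by
  intro ε' hε' hε
  obtain ⟨ρ, hρ, hsub⟩ := Metric.isOpen_iff.1 hO x hxO
  have hr : 0 < ρ / (l + 3) := by positivity
  have hball : ball x ((l + 3) * (ρ / (l + 3))) ⊆ O := by
    rwa [mul_div_cancel₀ _ (by positivity)]
  have hre : (α - n).re + Module.finrank ℝ (EuclideanSpace ℝ (Fin n)) = α.re := by simp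
  have hα_lt : α.re < a ∧ α.re < n := lt_min_iff.1 hα1
  have hk : (⌊α.re⌋.toNat : ℝ) ≤ α.re := by
    have h : ((⌊α.re⌋.toNat : ℤ) : ℝ) = ⌊α.re⌋ := by
      rw [Int.toNat_of_nonneg (Int.floor_nonneg.2 hα0.le)]
    rw [Int.cast_natCast] at h
    exact h.trans_le (Int.floor_le _)
  have hwithin : ∀ y ∈ O, iteratedFDerivWithin ℝ l f O y = iteratedFDeriv ℝ l f y :=
    iteratedFDerivWithin_of_isOpen l hO
  obtain ⟨hcd, M', hM'⟩ := RieszRegularity.contDiffOn_integral_mul_norm_cpow_and_holder volume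
    (β := α - n) (k := ⌊α.re⌋.toNat) (by simpa using hα_lt.2) (hre.symm ▸ hα0) (hre.symm ▸ hk)
    (hre.symm ▸ hα_lt.1) hfc hdecay hε' hε hε1 x M l hr (hCl.mono hball)
    (fun y hy z hz => by
      rw [← hwithin y (hball hy), ← hwithin z (hball hz)]
      exact hHolder y (hball hy) z (hball hz)) (Hfun n α)⁻¹
  refine ⟨ball x (ρ / (l + 3)), isOpen_ball, mem_ball_self hr, by exact_mod_cast hcd, M',
    fun y hy z hz => ?_⟩
  rw [iteratedFDerivWithin_of_isOpen _ isOpen_ball hy,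
    iteratedFDerivWithin_of_isOpen _ isOpen_ball hz]
  exact hM' y hy z hz
end

section
/- Let n ∈ ℕ, k ∈ {1, …, n-1}, and let f : ℝⁿ → ℂ be continuous such that f(x) = O(|x|^{-k-δ}) for some δ ∈ (0,1), and such that for every point of ℝⁿ there exist a neighborhood and an ε ∈ (0,1) on which f is Hölder continuous of index ε. Then for every x ∈ ℝⁿ the following holds: I^k f is well defined by an absolutely convergent integral, and there exist η > 0 and a holomorphic function F on the strip {α ∈ ℂ : -k - η < Re α < δ} such that F(α) = I^α(I^k f)(x) = (1/H_n(α)) ∫_{ℝⁿ} (I^k f)(y)|x - y|^{α-n} dy whenever 0 < Re α < δ, and F(-k) = f(x). (In the notation of the paper: I^{-k}(I^k f) = f for f ∈ C(k,n).) -/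
open Complex MeasureTheory Filter Asymptotics Set Metric

theorem intervalIntegrable_cpow_mul_sub_cpow {a b : ℂ} (ha : 0 < a.re) (hb : 0 < b.re) {u : ℝ}
    (hu : 0 < u) :
    IntervalIntegrable (fun s : ℝ => (s : ℂ) ^ (a - 1) * ((u : ℂ) - s) ^ (b - 1)) volume 0 u := by
  by_contra h
  have h1 := intervalIntegral.integral_undef h
  rw [Complex.betaIntegral_scaled a b hu] at h1
  have h2 := Complex.Gamma_mul_Gamma_eq_betaIntegral ha hb
  rcases mul_eq_zero.1 h1 with h3 | h3
  · rw [Complex.cpow_eq_zero_iff] at h3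
    exact hu.ne' (by exact_mod_cast h3.1)
  · rw [h3, mul_zero] at h2
    exact mul_ne_zero (Complex.Gamma_ne_zero_of_re_pos ha) (Complex.Gamma_ne_zero_of_re_pos hb) h2

/-- The Beta-type formula
`∫∫ s^(a-1) t^(b-1) φ(s+t) ds dt = B(a,b) ∫ u^(a+b-1) φ(u) du` on the positive quadrant. -/
theorem integrable_and_integral_cpow_mul_cpow_mul_comp_add {a b : ℂ} (ha : 0 < a.re)
    (hb : 0 < b.re) {φ : ℝ → ℂ} (hφ : Measurable φ)
    (hi : IntegrableOn (fun u : ℝ => (u : ℂ) ^ (a + b - 1) * φ u) (Ioi 0)) :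
    Integrable (fun p : ℝ × ℝ => (p.1 : ℂ) ^ (a - 1) * (p.2 : ℂ) ^ (b - 1) * φ (p.1 + p.2))
      ((volume.restrict (Ioi 0)).prod (volume.restrict (Ioi 0))) ∧
    ∫ p : ℝ × ℝ, (p.1 : ℂ) ^ (a - 1) * (p.2 : ℂ) ^ (b - 1) * φ (p.1 + p.2)
      ∂((volume.restrict (Ioi 0)).prod (volume.restrict (Ioi 0))) =
      betaIntegral a b * ∫ u in Ioi (0 : ℝ), (u : ℂ) ^ (a + b - 1) * φ u := by
  set S : Set (ℝ × ℝ) := {p | 0 < p.1 ∧ p.1 < p.2} with hS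
  have hSm : MeasurableSet S :=
    (measurableSet_lt measurable_const measurable_fst).inter
      (measurableSet_lt measurable_fst measurable_snd)
  set K : ℝ × ℝ → ℂ := S.indicator
    (fun p => (p.1 : ℂ) ^ (a - 1) * ((p.2 : ℂ) - p.1) ^ (b - 1) * φ p.2) with hK
  have hKm : Measurable K := by
    refine Measurable.indicator ?_ hSm
    fun_prop
  have hslice : ∀ u : ℝ, (fun s => K (s, u)) = (Ioo 0 u).indicator
      (fun s => (s : ℂ) ^ (a - 1) * ((u : ℂ) - s) ^ (b - 1) * φ u) := by
    intro u; ext s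
    simp only [hK, hS, indicator, mem_ofPred_eq, mem_Ioo]
  have hsliceint : ∀ u : ℝ, Integrable (fun s => K (s, u)) := by
    intro u
    rw [hslice, integrable_indicator_iff measurableSet_Ioo]
    rcases le_or_gt u 0 with hu | hu
    · rw [Ioo_eq_empty (by simpa using hu)]; exact integrableOn_empty
    · have := intervalIntegrable_cpow_mul_sub_cpow ha hb hu
      rw [intervalIntegrable_iff_integrableOn_Ioo_of_le hu.le] at this
      exact this.mul_const _
  have hval : ∀ u : ℝ, ∫ s, K (s, u) = (Ioi 0).indicator
      (fun u : ℝ => betaIntegral a b * ((u : ℂ) ^ (a + b - 1) * φ u)) u := by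
    intro u
    rw [hslice, integral_indicator measurableSet_Ioo]
    rcases le_or_gt u 0 with hu | hu
    · rw [Ioo_eq_empty (by simpa using hu), indicator_of_notMem (by simpa using hu)]; simp
    · rw [indicator_of_mem (by simpa using hu), ← integral_Ioc_eq_integral_Ioo,
        ← intervalIntegral.integral_of_le hu.le, intervalIntegral.integral_mul_const,
        Complex.betaIntegral_scaled a b hu]
      ring
  have hnorm : ∀ u : ℝ, ∫ s, ‖K (s, u)‖ = (Ioi 0).indicator
      (fun u : ℝ => ‖betaIntegral a.re b.re‖ * ‖(u : ℂ) ^ (a + b - 1) * φ u‖) u := by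
    intro u
    have h1 : (fun s => ‖K (s, u)‖) = (Ioo 0 u).indicator
        (fun s => ‖(s : ℂ) ^ (a - 1) * ((u : ℂ) - s) ^ (b - 1) * φ u‖) := by
      ext s; rw [congrFun (hslice u) s, norm_indicator_eq_indicator_norm]
    rw [h1, integral_indicator measurableSet_Ioo]
    rcases le_or_gt u 0 with hu | hu
    · rw [Ioo_eq_empty (by simpa using hu), indicator_of_notMem (by simpa using hu)]; simp
    · rw [indicator_of_mem (by simpa using hu), ← integral_Ioc_eq_integral_Ioo,
        ← intervalIntegral.integral_of_le hu.le]
      simp_rw [norm_mul]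
      rw [intervalIntegral.integral_mul_const]
      have h2 : ((∫ s in (0 : ℝ)..u, ‖(s : ℂ) ^ (a - 1)‖ * ‖((u : ℂ) - s) ^ (b - 1)‖ : ℝ) : ℂ) =
          (u : ℂ) ^ ((a.re : ℂ) + b.re - 1) * betaIntegral a.re b.re := by
        rw [← Complex.betaIntegral_scaled _ _ hu, ← intervalIntegral.integral_ofReal,
          intervalIntegral.integral_of_le hu.le, intervalIntegral.integral_of_le hu.le,
          integral_Ioc_eq_integral_Ioo, integral_Ioc_eq_integral_Ioo]
        refine setIntegral_congr_fun measurableSet_Ioo fun s hs => ?_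
        have hus : 0 < u - s := sub_pos.2 hs.2
        rw [Complex.norm_cpow_eq_rpow_re_of_pos hs.1, ← Complex.ofReal_sub,
          Complex.norm_cpow_eq_rpow_re_of_pos hus, Complex.ofReal_mul,
          Complex.ofReal_cpow hs.1.le, Complex.ofReal_cpow hus.le]
        simp
      have h3 : (∫ s in (0 : ℝ)..u, ‖(s : ℂ) ^ (a - 1)‖ * ‖((u : ℂ) - s) ^ (b - 1)‖) =
          ‖(u : ℂ) ^ (a + b - 1)‖ * ‖betaIntegral a.re b.re‖ := by
        have h4 : 0 ≤ ∫ s in (0 : ℝ)..u, ‖(s : ℂ) ^ (a - 1)‖ * ‖((u : ℂ) - s) ^ (b - 1)‖ :=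
          intervalIntegral.integral_nonneg hu.le fun _ _ => by positivity
        rw [← Real.norm_of_nonneg h4, ← Complex.norm_real, h2, norm_mul,
          Complex.norm_cpow_eq_rpow_re_of_pos hu, Complex.norm_cpow_eq_rpow_re_of_pos hu]
        simp
      rw [h3]; ring
  have hKi : Integrable K (volume.prod volume) := by
    rw [integrable_prod_iff' hKm.aestronglyMeasurable]
    refine ⟨Eventually.of_forall hsliceint, ?_⟩
    simp_rw [hnorm]
    exact (integrable_indicator_iff measurableSet_Ioi).2 (hi.norm.const_mul _)
  have hmp := measurePreserving_prod_add (volume : Measure ℝ) (volume : Measure ℝ)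
  have hcomp : K ∘ (fun z : ℝ × ℝ => (z.1, z.1 + z.2)) = (Ioi 0 ×ˢ Ioi 0).indicator
      (fun p : ℝ × ℝ => (p.1 : ℂ) ^ (a - 1) * (p.2 : ℂ) ^ (b - 1) * φ (p.1 + p.2)) := by
    ext p
    simp [hK, hS, indicator]
  rw [Measure.prod_restrict]
  have hQ : MeasurableSet (Ioi (0 : ℝ) ×ˢ Ioi (0 : ℝ)) := measurableSet_Ioi.prod measurableSet_Ioi
  constructor
  · rw [← IntegrableOn, ← integrable_indicator_iff hQ, ← hcomp]
    exact hmp.integrable_comp_of_integrable hKi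
  · rw [← integral_indicator hQ, ← hcomp]
    have hmap : ∫ p, K p ∂(volume.prod volume) =
        ∫ p, (K ∘ fun z : ℝ × ℝ => (z.1, z.1 + z.2)) p ∂(volume.prod volume) := by
      conv_lhs => rw [← hmp.map_eq]
      exact integral_map hmp.measurable.aemeasurable hKm.aestronglyMeasurable
    rw [← hmap, integral_prod_symm _ hKi]
    simp_rw [hval]
    rw [integral_indicator measurableSet_Ioi, integral_const_mul]

/-- The heat-type profile `s^(-n/2) exp(-r²/s)`. -/
noncomputable def heatProfile (n : ℕ) (r s : ℝ) : ℝ :=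
  s ^ (-(n : ℝ) / 2) * Real.exp (-(r ^ 2 / s))

theorem heatProfile_nonneg (n : ℕ) (r : ℝ) {s : ℝ} (hs : 0 ≤ s) : 0 ≤ heatProfile n r s := by
  unfold heatProfile; positivity

@[fun_prop]
theorem Measurable.heatProfile {X : Type*} [MeasurableSpace X] (n : ℕ) {r s : X → ℝ}
    (hr : Measurable r) (hs : Measurable s) :
    Measurable fun p => heatProfile n (r p) (s p) := by
  unfold _root_.heatProfile; fun_prop

theorem integral_cpow_mul_heatProfile (n : ℕ) {a : ℂ} (ha : a.re < n / 2) {r : ℝ} (hr : 0 < r) :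
    ∫ s in Ioi (0 : ℝ), (s : ℂ) ^ (a - 1) * (heatProfile n r s : ℂ) =
      Complex.Gamma (n / 2 - a) * (r : ℂ) ^ (2 * a - n) := by
  have hr2 : 0 < r ^ 2 := by positivity
  have h1 : ∫ s in Ioi (0 : ℝ), (s : ℂ) ^ (a - 1) * (heatProfile n r s : ℂ) =
      mellin (fun s : ℝ => (s : ℂ) ^ (-(n : ℂ) / 2) •
        (fun t : ℝ => Complex.exp (-((r ^ 2 : ℝ) * t))) s⁻¹) a := by
    refine setIntegral_congr_fun measurableSet_Ioi fun s hs => ?_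
    have hs' : (0 : ℝ) ≤ s := le_of_lt hs
    simp only [heatProfile, smul_eq_mul]
    rw [Complex.ofReal_mul, Complex.ofReal_cpow hs', Complex.ofReal_exp]
    push_cast
    rw [div_eq_mul_inv ((r : ℂ) ^ 2)]
  have hre : 0 < ((n : ℂ) / 2 - a).re := by
    have : ((n : ℂ) / 2 - a).re = n / 2 - a.re := by simp
    rw [this]; linarith
  rw [h1, mellin_cpow_smul,
    mellin_comp_inv (fun t : ℝ => Complex.exp (-((r ^ 2 : ℝ) * t)))]
  have h2 := Complex.integral_cpow_mul_exp_neg_mul_Ioi hre hr2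
  have h3 : -(a + -(n : ℂ) / 2) = n / 2 - a := by ring
  simp only [mellin, smul_eq_mul, h3]
  rw [h2, mul_comm]
  congr 1
  have hrc : (r : ℂ) ≠ 0 := by exact_mod_cast hr.ne'
  have : (1 / ((r ^ 2 : ℝ) : ℂ)) = ((r ^ (-2 : ℝ) : ℝ) : ℂ) := by
    rw [Real.rpow_neg hr.le]; norm_num
  rw [this, ← Complex.cpow_mul_ofReal_nonneg hr.le]
  congr 1
  push_cast
  ring

theorem integrableOn_cpow_mul_heatProfile (n : ℕ) {a : ℂ} (ha : a.re < n / 2) {r : ℝ}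
    (hr : 0 < r) :
    IntegrableOn (fun s : ℝ => (s : ℂ) ^ (a - 1) * (heatProfile n r s : ℂ)) (Ioi 0) := by
  by_contra h
  have h1 := integral_undef h
  rw [integral_cpow_mul_heatProfile n ha hr] at h1
  have hre : 0 < ((n : ℂ) / 2 - a).re := by
    have : ((n : ℂ) / 2 - a).re = n / 2 - a.re := by simp
    rw [this]; linarith
  rcases mul_eq_zero.1 h1 with h2 | h2
  · exact Complex.Gamma_ne_zero_of_re_pos hre h2
  · rw [Complex.cpow_eq_zero_iff] at h2
    exact hr.ne' (by exact_mod_cast h2.1)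

section Gaussian

variable {V : Type*} [NormedAddCommGroup V] [InnerProductSpace ℝ V]

theorem norm_sub_sq_div_add_norm_sub_sq_div (x y z : V) {s t : ℝ} (hs : 0 < s) (ht : 0 < t) :
    ‖x - y‖ ^ 2 / s + ‖y - z‖ ^ 2 / t = ‖x - z‖ ^ 2 / (s + t) +
      (s + t) / (s * t) * ‖y - ((t / (s + t)) • x + (s / (s + t)) • z)‖ ^ 2 := by
  set m := (t / (s + t)) • x + (s / (s + t)) • z with hm
  have hst : s + t ≠ 0 := by positivity
  have h1 : x - y = (s / (s + t)) • (x - z) - (y - m) := by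
    rw [hm]
    have : x = (s / (s + t)) • x + (t / (s + t)) • x := by
      rw [← add_smul, ← add_div, div_self hst, one_smul]
    nth_rewrite 1 [this]
    rw [smul_sub]; abel
  have h2 : y - z = (t / (s + t)) • (x - z) + (y - m) := by
    rw [hm]
    have : z = (s / (s + t)) • z + (t / (s + t)) • z := by
      rw [← add_smul, ← add_div, div_self hst, one_smul]
    nth_rewrite 1 [this]
    rw [smul_sub]; abel
  rw [h1, h2, norm_sub_sq_real, norm_add_sq_real, inner_smul_left, inner_smul_left, norm_smul,
    norm_smul, Real.norm_of_nonneg (by positivity), Real.norm_of_nonneg (by positivity)]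
  simp only [conj_trivial]
  field_simp
  ring

theorem heatProfile_mul_heatProfile (n : ℕ) (x y z : V) {s t : ℝ} (hs : 0 < s) (ht : 0 < t) :
    heatProfile n ‖x - y‖ s * heatProfile n ‖y - z‖ t =
      (s * t) ^ (-(n : ℝ) / 2) * Real.exp (-(‖x - z‖ ^ 2 / (s + t))) *
      Real.exp (-((s + t) / (s * t)) * ‖y - ((t / (s + t)) • x + (s / (s + t)) • z)‖ ^ 2) := by
  unfold heatProfile
  rw [Real.mul_rpow hs.le ht.le, mul_assoc (_ * _), ← Real.exp_add]
  have := norm_sub_sq_div_add_norm_sub_sq_div x y z hs ht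
  have h2 : -(‖x - z‖ ^ 2 / (s + t)) +
      -((s + t) / (s * t)) * ‖y - ((t / (s + t)) • x + (s / (s + t)) • z)‖ ^ 2 =
      -(‖x - y‖ ^ 2 / s) + -(‖y - z‖ ^ 2 / t) := by linarith
  rw [h2, Real.exp_add]; ring

variable [FiniteDimensional ℝ V] [MeasurableSpace V] [BorelSpace V]

theorem integrable_rexp_neg_mul_norm_sq {b : ℝ} (hb : 0 < b) :
    Integrable fun v : V => Real.exp (-b * ‖v‖ ^ 2) := by
  by_contra h
  have h1 := integral_undef h
  rw [GaussianFourier.integral_rexp_neg_mul_sq_norm hb] at h1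
  have : 0 < Real.pi / b := by positivity
  exact (Real.rpow_pos_of_pos this _).ne' h1

theorem integrable_heatProfile_mul_heatProfile (n : ℕ) (x z : V) {s t : ℝ} (hs : 0 < s)
    (ht : 0 < t) :
    Integrable fun y : V => heatProfile n ‖x - y‖ s * heatProfile n ‖y - z‖ t := by
  simp_rw [heatProfile_mul_heatProfile n x _ z hs ht]
  have hb : 0 < (s + t) / (s * t) := by positivity
  exact ((integrable_rexp_neg_mul_norm_sq (V := V) hb).comp_sub_right _).const_mul _

/-- The semigroup property of the heat-type profile. -/
theorem integral_heatProfile_mul_heatProfile (x z : V) {s t : ℝ} (hs : 0 < s) (ht : 0 < t) :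
    ∫ y : V, heatProfile (Module.finrank ℝ V) ‖x - y‖ s *
      heatProfile (Module.finrank ℝ V) ‖y - z‖ t =
      Real.pi ^ ((Module.finrank ℝ V : ℝ) / 2) *
        heatProfile (Module.finrank ℝ V) ‖x - z‖ (s + t) := by
  simp_rw [heatProfile_mul_heatProfile _ x _ z hs ht]
  have hb : 0 < (s + t) / (s * t) := by positivity
  rw [integral_const_mul, integral_sub_right_eq_self (fun v : V =>
    Real.exp (-((s + t) / (s * t)) * ‖v‖ ^ 2)), GaussianFourier.integral_rexp_neg_mul_sq_norm hb,
    heatProfile, neg_div, Real.rpow_neg (by positivity), Real.rpow_neg (by positivity)]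
  have h1 : Real.pi / ((s + t) / (s * t)) = Real.pi * (s * t) / (s + t) := by
    field_simp
  rw [h1, Real.div_rpow (by positivity) (by positivity),
    Real.mul_rpow Real.pi_pos.le (mul_pos hs ht).le]
  have h2 : (s * t) ^ ((Module.finrank ℝ V : ℝ) / 2) ≠ 0 := by positivity
  field_simp

end Gaussian

section Composition

variable {V : Type*} [NormedAddCommGroup V] [InnerProductSpace ℝ V] [FiniteDimensional ℝ V]
  [MeasurableSpace V] [BorelSpace V]

theorem integrable_and_integral_norm_cpow_mul_norm_cpow [Nontrivial V] {x z : V} (hxz : x ≠ z)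
    {α β : ℂ} (hα : 0 < α.re) (hβ : 0 < β.re) (hαβ : (α + β).re < Module.finrank ℝ V) :
    (Integrable fun y : V => (‖x - y‖ : ℂ) ^ (α - Module.finrank ℝ V) *
      (‖y - z‖ : ℂ) ^ (β - Module.finrank ℝ V)) ∧
    Complex.Gamma ((Module.finrank ℝ V - α) / 2) * Complex.Gamma ((Module.finrank ℝ V - β) / 2) *
      ∫ y : V, (‖x - y‖ : ℂ) ^ (α - Module.finrank ℝ V) *
        (‖y - z‖ : ℂ) ^ (β - Module.finrank ℝ V) =
      (Real.pi : ℂ) ^ ((Module.finrank ℝ V : ℂ) / 2) * betaIntegral (α / 2) (β / 2) *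
        Complex.Gamma ((Module.finrank ℝ V - (α + β)) / 2) *
        (‖x - z‖ : ℂ) ^ (α + β - Module.finrank ℝ V) := by
  set d := Module.finrank ℝ V with hd
  set a := α / 2 with ha
  set b := β / 2 with hb
  have e1 : α = 2 * a := by rw [ha]; ring
  have e2 : β = 2 * b := by rw [hb]; ring
  have are : a.re = α.re / 2 := by rw [e1]; simp
  have bre : b.re = β.re / 2 := by rw [e2]; simp
  have hare : 0 < a.re := by rw [are]; positivity
  have hbre : 0 < b.re := by rw [bre]; positivity
  have hsum : α.re + β.re < d := by simpa using hαβ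
  have hr : 0 < ‖x - z‖ := norm_pos_iff.2 (sub_ne_zero.2 hxz)
  have hab : (a + b).re < (d : ℝ) / 2 := by rw [Complex.add_re, are, bre]; linarith
  have ha2 : a.re < (d : ℝ) / 2 := by rw [are]; linarith
  have hb2 : b.re < (d : ℝ) / 2 := by rw [bre]; linarith
  set μ : Measure (ℝ × ℝ) := (volume.restrict (Ioi 0)).prod (volume.restrict (Ioi 0)) with hμ
  have hpos : ∀ᵐ p ∂μ, 0 < p.1 ∧ 0 < p.2 := by
    rw [hμ, Measure.prod_restrict]
    filter_upwards [ae_restrict_mem (measurableSet_Ioi.prod measurableSet_Ioi)] with p hp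
    exact hp
  obtain ⟨hB1, hB2⟩ := integrable_and_integral_cpow_mul_cpow_mul_comp_add hare hbre
    (φ := fun u => (heatProfile d ‖x - z‖ u : ℂ)) (by fun_prop)
    (integrableOn_cpow_mul_heatProfile d hab hr)
  set G : V × (ℝ × ℝ) → ℂ := fun q =>
    ((q.2.1 : ℂ) ^ (a - 1) * (heatProfile d ‖x - q.1‖ q.2.1 : ℂ)) *
      ((q.2.2 : ℂ) ^ (b - 1) * (heatProfile d ‖q.1 - z‖ q.2.2 : ℂ)) with hG
  have hGm : Measurable G := by fun_prop
  have hGfac : ∀ y p, G (y, p) = ((p.1 : ℂ) ^ (a - 1) * (p.2 : ℂ) ^ (b - 1)) *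
      ((heatProfile d ‖x - y‖ p.1 * heatProfile d ‖y - z‖ p.2 : ℝ) : ℂ) := by
    intro y p; simp only [hG]; push_cast; ring
  have hGi : Integrable G (volume.prod μ) := by
    rw [integrable_prod_iff' hGm.aestronglyMeasurable]
    constructor
    · filter_upwards [hpos] with p hp
      simp_rw [hGfac]
      exact ((integrable_heatProfile_mul_heatProfile d x z hp.1 hp.2).ofReal).const_mul _
    · refine (hB1.norm.const_mul (Real.pi ^ ((d : ℝ) / 2))).congr ?_
      filter_upwards [hpos] with p hp
      simp_rw [hGfac, norm_mul _ (Complex.ofReal _)]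
      rw [integral_const_mul]
      have : ∀ y, ‖((heatProfile d ‖x - y‖ p.1 * heatProfile d ‖y - z‖ p.2 : ℝ) : ℂ)‖ =
          heatProfile d ‖x - y‖ p.1 * heatProfile d ‖y - z‖ p.2 := fun y => by
        rw [Complex.norm_real, Real.norm_of_nonneg
          (mul_nonneg (heatProfile_nonneg _ _ hp.1.le) (heatProfile_nonneg _ _ hp.2.le))]
      simp_rw [this]
      rw [integral_heatProfile_mul_heatProfile x z hp.1 hp.2, norm_mul, Complex.norm_real,
        Real.norm_of_nonneg (heatProfile_nonneg _ _ (add_pos hp.1 hp.2).le)]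
      ring
  have hinner : ∀ᵐ y : V, ∫ p, G (y, p) ∂μ =
      Complex.Gamma ((d - α) / 2) * Complex.Gamma ((d - β) / 2) *
        ((‖x - y‖ : ℂ) ^ (α - d) * (‖y - z‖ : ℂ) ^ (β - d)) := by
    filter_upwards [compl_mem_ae_iff.2 (measure_singleton x),
      compl_mem_ae_iff.2 (measure_singleton z)] with y hy1 hy2
    have h1 : 0 < ‖x - y‖ := norm_pos_iff.2 (sub_ne_zero.2 (Ne.symm hy1))
    have h2 : 0 < ‖y - z‖ := norm_pos_iff.2 (sub_ne_zero.2 hy2)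
    simp only [hG]
    rw [hμ, integral_prod_mul (fun s : ℝ => (s : ℂ) ^ (a - 1) * (heatProfile d ‖x - y‖ s : ℂ))
      (fun s : ℝ => (s : ℂ) ^ (b - 1) * (heatProfile d ‖y - z‖ s : ℂ)),
      integral_cpow_mul_heatProfile d ha2 h1, integral_cpow_mul_heatProfile d hb2 h2,
      ← e1, ← e2, ha, hb, sub_div, sub_div]
    ring
  have hΓ : Complex.Gamma ((d - α) / 2) * Complex.Gamma ((d - β) / 2) ≠ 0 := by
    refine mul_ne_zero (Complex.Gamma_ne_zero_of_re_pos ?_) (Complex.Gamma_ne_zero_of_re_pos ?_)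
    · have : (((d : ℂ) - α) / 2).re = (d - α.re) / 2 := by simp
      rw [this]; linarith
    · have : (((d : ℂ) - β) / 2).re = (d - β.re) / 2 := by simp
      rw [this]; linarith
  constructor
  · have h := (hGi.integral_prod_left.congr hinner).const_mul
      (Complex.Gamma ((d - α) / 2) * Complex.Gamma ((d - β) / 2))⁻¹
    simpa only [inv_mul_cancel_left₀ hΓ] using h
  · rw [← integral_const_mul, ← integral_congr_ae hinner,
      integral_integral_swap (f := fun y p => G (y, p)) hGi]
    have : ∀ᵐ p ∂μ, ∫ y, G (y, p) = (Real.pi : ℂ) ^ ((d : ℂ) / 2) *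
        ((p.1 : ℂ) ^ (a - 1) * (p.2 : ℂ) ^ (b - 1) * (heatProfile d ‖x - z‖ (p.1 + p.2) : ℂ)) := by
      filter_upwards [hpos] with p hp
      simp_rw [hGfac]
      rw [integral_const_mul, integral_complex_ofReal, integral_heatProfile_mul_heatProfile x z hp.1 hp.2,
        Complex.ofReal_mul, Complex.ofReal_cpow Real.pi_pos.le]
      push_cast
      ring
    rw [integral_congr_ae this, integral_const_mul, hB2, integral_cpow_mul_heatProfile d hab hr,
      e1, e2]
    have h3 : (d : ℂ) / 2 - (a + b) = (d - (2 * a + 2 * b)) / 2 := by ring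
    have h4 : 2 * (a + b) - (d : ℂ) = 2 * a + 2 * b - d := by ring
    rw [h3, h4]; ring

end Composition

theorem isBigO_one_add_rpow_neg_atTop {c : ℝ} (hc : 0 ≤ c) :
    (fun r : ℝ => (1 + r) ^ (-c)) =O[atTop] fun r => r ^ (-c) := by
  refine IsBigO.of_bound 1 ?_
  filter_upwards [eventually_gt_atTop 0] with r hr
  rw [Real.norm_of_nonneg (by positivity), Real.norm_of_nonneg (by positivity), one_mul]
  exact Real.rpow_le_rpow_of_nonpos hr (by linarith) (by linarith)

section Decay

variable {V : Type*} [NormedAddCommGroup V]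

theorem one_add_norm_sub_rpow_neg_le (x w : V) {c : ℝ} (hc : 0 ≤ c) :
    (1 + ‖x - w‖) ^ (-c) ≤ (1 + ‖x‖) ^ c * (1 + ‖w‖) ^ (-c) := by
  have h1 : 1 + ‖w‖ ≤ (1 + ‖x‖) * (1 + ‖x - w‖) := by
    have : ‖w‖ ≤ ‖x‖ + ‖x - w‖ := by
      calc ‖w‖ = ‖x - (x - w)‖ := by rw [sub_sub_cancel]
        _ ≤ _ := norm_sub_le _ _
    nlinarith [norm_nonneg x, norm_nonneg (x - w)]
  have hp : 0 < 1 + ‖x‖ := by positivity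
  have hq : 0 < 1 + ‖x - w‖ := by positivity
  have hw : 0 < 1 + ‖w‖ := by positivity
  have h2 := Real.rpow_le_rpow hw.le h1 hc
  rw [Real.mul_rpow hp.le hq.le] at h2
  rw [Real.rpow_neg hq.le, Real.rpow_neg hw.le, ← div_eq_mul_inv, inv_eq_one_div,
    div_le_div_iff₀ (by positivity) (by positivity), one_mul]
  exact h2

theorem exists_norm_le_mul_one_add_norm_rpow_neg [ProperSpace V] {f : V → ℂ} (hfc : Continuous f) {c : ℝ}
    (hc : 0 ≤ c) (hdecay : f =O[cocompact V] fun y => ‖y‖ ^ (-c)) :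
    ∃ C : ℝ, 0 ≤ C ∧ ∀ y, ‖f y‖ ≤ C * (1 + ‖y‖) ^ (-c) := by
  obtain ⟨C₁, hC₁, h1⟩ := hdecay.exists_pos
  rw [IsBigOWith, Filter.eventually_iff, mem_cocompact] at h1
  obtain ⟨K, hK, hKs⟩ := h1
  obtain ⟨C₂, hC₂⟩ := (hK.union (isCompact_closedBall (0 : V) 1)).exists_bound_of_continuousOn
    (f := fun y => (((1 + ‖y‖) ^ c : ℝ) : ℂ) * f y) (by
      refine Continuous.continuousOn ?_
      refine Continuous.mul (Complex.continuous_ofReal.comp ?_) hfc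
      exact (continuous_const.add continuous_norm).rpow_const fun y => Or.inr hc)
  refine ⟨max C₂ (C₁ * 2 ^ c), le_max_of_le_right (by positivity), fun y => ?_⟩
  have hy : 0 < 1 + ‖y‖ := by positivity
  rw [Real.rpow_neg hy.le, ← div_eq_mul_inv, le_div_iff₀ (by positivity)]
  by_cases hyK : y ∈ K ∪ closedBall 0 1
  · refine le_max_of_le_left ?_
    have := hC₂ y hyK
    rwa [norm_mul, Complex.norm_real, Real.norm_of_nonneg (by positivity), mul_comm] at this
  · refine le_max_of_le_right ?_
    simp only [mem_union, not_or, mem_closedBall, dist_zero_right, not_le] at hyK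
    have h2 : ‖f y‖ ≤ C₁ * ‖‖y‖ ^ (-c)‖ := hKs hyK.1
    have hy0 : 0 < ‖y‖ := by linarith [hyK.2]
    rw [Real.norm_of_nonneg (by positivity), Real.rpow_neg hy0.le, ← div_eq_mul_inv,
      le_div_iff₀ (by positivity)] at h2
    have h3 : (1 + ‖y‖) ^ c ≤ 2 ^ c * ‖y‖ ^ c := by
      rw [← Real.mul_rpow (by norm_num) hy0.le]
      exact Real.rpow_le_rpow hy.le (by linarith [hyK.2]) hc
    calc ‖f y‖ * (1 + ‖y‖) ^ c ≤ ‖f y‖ * (2 ^ c * ‖y‖ ^ c) := by gcongr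
      _ = 2 ^ c * (‖f y‖ * ‖y‖ ^ c) := by ring
      _ ≤ 2 ^ c * C₁ := by gcongr
      _ = C₁ * 2 ^ c := by ring

variable [InnerProductSpace ℝ V] [FiniteDimensional ℝ V] [MeasurableSpace V] [BorelSpace V]

theorem integrable_one_add_norm_rpow_neg_mul_norm_rpow [Nontrivial V] {b c : ℝ} (hb : 0 < b)
    (hbc : b < c) :
    Integrable fun w : V => (1 + ‖w‖) ^ (-c) * ‖w‖ ^ (b - Module.finrank ℝ V) := by
  have hc : 0 ≤ c := by linarith
  rw [integrable_fun_norm_addHaar volume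
    (f := fun r : ℝ => (1 + r) ^ (-c) * r ^ (b - Module.finrank ℝ V))]
  have h := mellin_convergent_of_isBigO_scalar (a := c) (b := 0) (s := b)
    (f := fun r : ℝ => (1 + r) ^ (-c)) ?_ (isBigO_one_add_rpow_neg_atTop hc) hbc ?_ hb
  · refine h.congr_fun (fun r hr => ?_) measurableSet_Ioi
    have hr' : (0 : ℝ) < r := hr
    have hd : 0 < Module.finrank ℝ V := Module.finrank_pos
    have : r ^ (b - 1) = r ^ (Module.finrank ℝ V - 1) * r ^ (b - Module.finrank ℝ V) := by
      rw [← Real.rpow_natCast, ← Real.rpow_add hr', Nat.cast_sub hd]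
      congr 1
      push_cast
      ring
    simp only [smul_eq_mul, this]
    ring
  · refine ContinuousOn.locallyIntegrableOn ?_ measurableSet_Ioi
    refine ContinuousOn.rpow_const (by fun_prop) fun r hr => Or.inl ?_
    have hr' : (0 : ℝ) < r := hr
    positivity
  · refine IsBigO.of_bound 1 ?_
    filter_upwards [self_mem_nhdsWithin] with r hr
    have hr' : (0 : ℝ) < r := hr
    rw [Real.norm_of_nonneg (by positivity), neg_zero, Real.rpow_zero, norm_one, mul_one]
    exact Real.rpow_le_one_of_one_le_of_nonpos (by linarith) (by linarith)

theorem integrable_comp_sub_mul_norm_cpow [Nontrivial V] {f : V → ℂ} (hfm : Measurable f) {c C : ℝ}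
    (hC : 0 ≤ C) (hf : ∀ y, ‖f y‖ ≤ C * (1 + ‖y‖) ^ (-c)) {β : ℂ} (hβ : 0 < β.re) (hβc : β.re < c)
    (x : V) :
    Integrable fun w : V => f (x - w) * (‖w‖ : ℂ) ^ (β - Module.finrank ℝ V) := by
  have hc : 0 ≤ c := by linarith
  refine ((integrable_one_add_norm_rpow_neg_mul_norm_rpow (V := V) hβ hβc).const_mul
    (C * (1 + ‖x‖) ^ c)).mono' (by fun_prop) ?_
  filter_upwards [compl_mem_ae_iff.2 (measure_singleton (0 : V))] with w hw
  have hw' : 0 < ‖w‖ := norm_pos_iff.2 hw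
  rw [norm_mul, Complex.norm_cpow_eq_rpow_re_of_pos hw', ← mul_assoc]
  have : (β - Module.finrank ℝ V).re = β.re - Module.finrank ℝ V := by simp
  rw [this]
  gcongr
  calc ‖f (x - w)‖ ≤ C * (1 + ‖x - w‖) ^ (-c) := hf _
    _ ≤ C * ((1 + ‖x‖) ^ c * (1 + ‖w‖) ^ (-c)) := by
        gcongr; exact one_add_norm_sub_rpow_neg_le x w hc
    _ = _ := by ring

theorem integrable_mul_norm_sub_cpow [Nontrivial V] {f : V → ℂ} (hfm : Measurable f) {c C : ℝ}
    (hC : 0 ≤ C) (hf : ∀ y, ‖f y‖ ≤ C * (1 + ‖y‖) ^ (-c)) {β : ℂ} (hβ : 0 < β.re) (hβc : β.re < c)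
    (x : V) :
    Integrable fun y : V => f y * (‖x - y‖ : ℂ) ^ (β - Module.finrank ℝ V) := by
  have h := (integrable_comp_sub_mul_norm_cpow hfm hC hf hβ hβc x).comp_sub_left x
  simpa only [sub_sub_cancel] using h

end Decay

theorem Hfun_ne_zero {n : ℕ} {α : ℂ} (h0 : 0 < α.re) (hn : α.re < n) : Hfun n α ≠ 0 := by
  have h1 : 0 < (α / 2).re := by
    have : (α / 2).re = α.re / 2 := by simp
    rw [this]; positivity
  have h2 : 0 < (((n : ℂ) - α) / 2).re := by
    have : (((n : ℂ) - α) / 2).re = (n - α.re) / 2 := by simp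
    rw [this]; linarith
  have hpi : (Real.pi : ℂ) ≠ 0 := by exact_mod_cast Real.pi_ne_zero
  unfold Hfun
  refine div_ne_zero (mul_ne_zero (mul_ne_zero ?_ ?_) (Complex.Gamma_ne_zero_of_re_pos h1))
    (Complex.Gamma_ne_zero_of_re_pos h2)
  · exact fun h => two_ne_zero ((Complex.cpow_eq_zero_iff _ _).1 h).1
  · exact fun h => hpi ((Complex.cpow_eq_zero_iff _ _).1 h).1

section Semigroup

variable {n : ℕ}

/-- The composition formula for the Riesz kernels. -/
theorem integral_norm_cpow_mul_norm_cpow_eq_Hfun [Nonempty (Fin n)]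
    {x z : EuclideanSpace ℝ (Fin n)} (hxz : x ≠ z)
    {α β : ℂ} (hα : 0 < α.re) (hβ : 0 < β.re) (hαβ : (α + β).re < n) :
    (Integrable fun y : EuclideanSpace ℝ (Fin n) =>
      (‖x - y‖ : ℂ) ^ (α - n) * (‖y - z‖ : ℂ) ^ (β - n)) ∧
    ∫ y : EuclideanSpace ℝ (Fin n), (‖x - y‖ : ℂ) ^ (α - n) * (‖y - z‖ : ℂ) ^ (β - n) =
      Hfun n α * Hfun n β * (Hfun n (α + β))⁻¹ * (‖x - z‖ : ℂ) ^ (α + β - n) := by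
  have h := integrable_and_integral_norm_cpow_mul_norm_cpow hxz hα hβ (by simpa using hαβ)
  simp only [finrank_euclideanSpace, Fintype.card_fin] at h
  refine ⟨h.1, ?_⟩
  have h2 := h.2
  have hsum : α.re + β.re < n := by simpa using hαβ
  have are : (α / 2).re = α.re / 2 := by simp
  have bre : (β / 2).re = β.re / 2 := by simp
  have h3 := Complex.Gamma_mul_Gamma_eq_betaIntegral (s := α / 2) (t := β / 2)
    (by rw [are]; positivity) (by rw [bre]; positivity)
  have g1 : Complex.Gamma (((n : ℂ) - α) / 2) ≠ 0 := Complex.Gamma_ne_zero_of_re_pos (by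
    have : (((n : ℂ) - α) / 2).re = (n - α.re) / 2 := by simp
    rw [this]; linarith)
  have g2 : Complex.Gamma (((n : ℂ) - β) / 2) ≠ 0 := Complex.Gamma_ne_zero_of_re_pos (by
    have : (((n : ℂ) - β) / 2).re = (n - β.re) / 2 := by simp
    rw [this]; linarith)
  have g3 : Complex.Gamma (((n : ℂ) - (α + β)) / 2) ≠ 0 := Complex.Gamma_ne_zero_of_re_pos (by
    have : (((n : ℂ) - (α + β)) / 2).re = (n - (α.re + β.re)) / 2 := by simp
    rw [this]; linarith)
  have g4 : Complex.Gamma ((α + β) / 2) ≠ 0 := Complex.Gamma_ne_zero_of_re_pos (by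
    have : ((α + β) / 2).re = (α.re + β.re) / 2 := by simp
    rw [this]; linarith)
  have hpi : (Real.pi : ℂ) ≠ 0 := by exact_mod_cast Real.pi_ne_zero
  have g5 : (Real.pi : ℂ) ^ ((n : ℂ) / 2) ≠ 0 := fun h => hpi ((Complex.cpow_eq_zero_iff _ _).1 h).1
  have g6 : (2 : ℂ) ^ α ≠ 0 := fun h => two_ne_zero ((Complex.cpow_eq_zero_iff _ _).1 h).1
  have g7 : (2 : ℂ) ^ β ≠ 0 := fun h => two_ne_zero ((Complex.cpow_eq_zero_iff _ _).1 h).1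
  rw [← add_div] at h3
  unfold Hfun
  rw [Complex.cpow_add _ _ two_ne_zero]
  set I := ∫ y : EuclideanSpace ℝ (Fin n), (‖x - y‖ : ℂ) ^ (α - n) * (‖y - z‖ : ℂ) ^ (β - n)
  refine mul_left_cancel₀ (mul_ne_zero (mul_ne_zero g1 g2) g4) ?_
  have h5 : Complex.Gamma (((n : ℂ) - α) / 2) * Complex.Gamma (((n : ℂ) - β) / 2) *
      Complex.Gamma ((α + β) / 2) * I = Complex.Gamma (α / 2) * Complex.Gamma (β / 2) *
        (Real.pi : ℂ) ^ ((n : ℂ) / 2) * Complex.Gamma (((n : ℂ) - (α + β)) / 2) *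
        (‖x - z‖ : ℂ) ^ (α + β - n) := by
    rw [h3]
    linear_combination Complex.Gamma ((α + β) / 2) * h2
  rw [h5]
  field_simp

theorem integral_norm_norm_cpow_mul_norm_cpow [Nonempty (Fin n)] {α β : ℂ} (hα : 0 < α.re)
    (hβ : 0 < β.re) (hαβ : (α + β).re < n) (x : EuclideanSpace ℝ (Fin n)) :
    ∃ M : ℝ, ∀ z, x ≠ z → ∫ y : EuclideanSpace ℝ (Fin n),
      ‖(‖x - y‖ : ℂ) ^ (α - n) * (‖y - z‖ : ℂ) ^ (β - n)‖ =
        M * ‖(‖x - z‖ : ℂ) ^ (α + β - n)‖ := by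
  refine ⟨‖Hfun n α.re * Hfun n β.re * (Hfun n (α.re + β.re))⁻¹‖, fun z hxz => ?_⟩
  have h := (integral_norm_cpow_mul_norm_cpow_eq_Hfun hxz (α := α.re) (β := β.re)
    (by simpa using hα) (by simpa using hβ) (by simpa using hαβ)).2
  have h1 : ((∫ y : EuclideanSpace ℝ (Fin n),
      ‖(‖x - y‖ : ℂ) ^ (α - n) * (‖y - z‖ : ℂ) ^ (β - n)‖ : ℝ) : ℂ) =
      ∫ y : EuclideanSpace ℝ (Fin n),
        (‖x - y‖ : ℂ) ^ ((α.re : ℂ) - n) * (‖y - z‖ : ℂ) ^ ((β.re : ℂ) - n) := by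
    rw [← integral_complex_ofReal]
    refine integral_congr_ae ?_
    filter_upwards [compl_mem_ae_iff.2 (measure_singleton x),
      compl_mem_ae_iff.2 (measure_singleton z)] with y hy1 hy2
    have h1 : 0 < ‖x - y‖ := norm_pos_iff.2 (sub_ne_zero.2 (Ne.symm hy1))
    have h2 : 0 < ‖y - z‖ := norm_pos_iff.2 (sub_ne_zero.2 hy2)
    rw [norm_mul, Complex.norm_cpow_eq_rpow_re_of_pos h1, Complex.norm_cpow_eq_rpow_re_of_pos h2,
      Complex.ofReal_mul, Complex.ofReal_cpow h1.le, Complex.ofReal_cpow h2.le]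
    simp
  have h2 : 0 ≤ ∫ y : EuclideanSpace ℝ (Fin n),
      ‖(‖x - y‖ : ℂ) ^ (α - n) * (‖y - z‖ : ℂ) ^ (β - n)‖ :=
    integral_nonneg fun _ => norm_nonneg _
  have hr : 0 < ‖x - z‖ := norm_pos_iff.2 (sub_ne_zero.2 hxz)
  rw [← Real.norm_of_nonneg h2, ← Complex.norm_real, h1, h, norm_mul,
    Complex.norm_cpow_eq_rpow_re_of_pos hr, Complex.norm_cpow_eq_rpow_re_of_pos hr]
  simp

/-- The semigroup property of the Riesz potentials of a decaying function. -/
theorem riesz_riesz [Nonempty (Fin n)] {f : EuclideanSpace ℝ (Fin n) → ℂ} (hfm : Measurable f)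
    {c C : ℝ} (hC : 0 ≤ C) (hf : ∀ y, ‖f y‖ ≤ C * (1 + ‖y‖) ^ (-c)) {α β : ℂ} (hα : 0 < α.re)
    (hβ : 0 < β.re) (hc : (α + β).re < c) (hn : (α + β).re < n)
    (x : EuclideanSpace ℝ (Fin n)) :
    riesz n (riesz n f β) α x = riesz n f (α + β) x := by
  have hαβ : 0 < (α + β).re := by rw [Complex.add_re]; positivity
  set G : EuclideanSpace ℝ (Fin n) × EuclideanSpace ℝ (Fin n) → ℂ := fun p =>
    f p.2 * ((‖x - p.1‖ : ℂ) ^ (α - n) * (‖p.1 - p.2‖ : ℂ) ^ (β - n)) with hG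
  have hGm : Measurable G := by fun_prop
  obtain ⟨M, hM⟩ := integral_norm_norm_cpow_mul_norm_cpow hα hβ hn x
  have hae : ∀ᵐ z : EuclideanSpace ℝ (Fin n), x ≠ z := by
    filter_upwards [compl_mem_ae_iff.2 (measure_singleton x)] with z hz using Ne.symm hz
  have hint := integrable_mul_norm_sub_cpow hfm hC hf hαβ hc x
  rw [finrank_euclideanSpace, Fintype.card_fin] at hint
  have hGi : Integrable G (volume.prod volume) := by
    rw [integrable_prod_iff' hGm.aestronglyMeasurable]
    constructor
    · filter_upwards [hae] with z hz
      simpa only [hG] using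
        (integral_norm_cpow_mul_norm_cpow_eq_Hfun hz hα hβ hn).1.const_mul (f z)
    · refine (hint.norm.const_mul M).congr ?_
      filter_upwards [hae] with z hz
      simp only [hG]
      simp_rw [norm_mul (f z)]
      rw [integral_const_mul, hM z hz]
      ring
  have h1 : ∀ y, riesz n f β y * (‖x - y‖ : ℂ) ^ (α - n) = (Hfun n β)⁻¹ * ∫ z, G (y, z) := by
    intro y
    simp only [riesz, hG]
    rw [mul_assoc, ← integral_mul_const]
    congr 1
    refine integral_congr_ae (Eventually.of_forall fun z => ?_)
    ring
  have h2 : ∀ᵐ z, ∫ y, G (y, z) = Hfun n α * Hfun n β * (Hfun n (α + β))⁻¹ *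
      (f z * (‖x - z‖ : ℂ) ^ (α + β - n)) := by
    filter_upwards [hae] with z hz
    simp only [hG]
    rw [integral_const_mul, (integral_norm_cpow_mul_norm_cpow_eq_Hfun hz hα hβ hn).2]
    ring
  rw [Complex.add_re] at hn
  have hHα := Hfun_ne_zero (n := n) hα (by linarith)
  have hHβ := Hfun_ne_zero (n := n) hβ (by linarith)
  rw [riesz]
  simp_rw [h1]
  rw [integral_const_mul, integral_integral_swap (f := fun y z => G (y, z)) hGi,
    integral_congr_ae h2, integral_const_mul, riesz]
  field_simp

end Semigroup

section Polar

open scoped Topology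

variable {V : Type*} [NormedAddCommGroup V] [InnerProductSpace ℝ V] [FiniteDimensional ℝ V]
  [MeasurableSpace V] [BorelSpace V]

/-- Integration in polar coordinates. -/
theorem integral_eq_integral_Ioi_integral_sphere [Nontrivial V] {F : V → ℂ} (hF : Integrable F) :
    ∫ w, F w = ∫ r in Ioi (0 : ℝ), r ^ (Module.finrank ℝ V - 1) •
      ∫ ω : sphere (0 : V) 1, F (r • (ω : V)) ∂(volume : Measure V).toSphere := by
  set e := homeomorphUnitSphereProd V
  set k := Module.finrank ℝ V - 1
  have hmp := (volume : Measure V).measurePreserving_homeomorphUnitSphereProd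
  have hemb : MeasurableEmbedding e := Homeomorph.measurableEmbedding _
  set P : sphere (0 : V) 1 × Ioi (0 : ℝ) → ℂ := fun p => F ((p.2 : ℝ) • (p.1 : V)) with hP
  have hcomp : ∀ w : ({0}ᶜ : Set V), P (e w) = F w := by
    intro w
    have hw : ‖(w : V)‖ ≠ 0 := norm_ne_zero_iff.2 w.2
    simp [hP, e, smul_smul, hw]
  have hPi : Integrable P ((volume : Measure V).toSphere.prod (Measure.volumeIoiPow k)) := by
    rw [← hmp.integrable_comp_emb hemb]
    have : P ∘ e = fun w : ({0}ᶜ : Set V) => F w := funext hcomp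
    rw [this]
    have h := hF.integrableOn (s := ({0}ᶜ : Set V))
    rwa [integrableOn_iff_comap_subtypeVal (measurableSet_singleton _).compl] at h
  calc ∫ w, F w = ∫ w : ({0}ᶜ : Set V), F w ∂(Measure.comap Subtype.val volume) := by
        rw [integral_subtype_comap (measurableSet_singleton _).compl F,
          restrict_compl_singleton]
    _ = ∫ p, P p ∂(volume : Measure V).toSphere.prod (Measure.volumeIoiPow k) := by
        rw [← hmp.integral_comp hemb]
        exact integral_congr_ae (Eventually.of_forall fun w => (hcomp w).symm)
    _ = ∫ r : Ioi (0 : ℝ), ∫ ω, P (ω, r) ∂(volume : Measure V).toSphere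
          ∂(Measure.volumeIoiPow k) := integral_prod_symm _ hPi
    _ = _ := by
        simp only [Measure.volumeIoiPow, ENNReal.ofReal, hP]
        rw [integral_withDensity_eq_integral_smul, integral_subtype_comap measurableSet_Ioi
          fun r : ℝ => Real.toNNReal (r ^ k) •
            ∫ ω : sphere (0 : V) 1, F (r • (ω : V)) ∂(volume : Measure V).toSphere]
        · refine setIntegral_congr_fun measurableSet_Ioi fun r hr => ?_
          have hr' : (0 : ℝ) < r := hr
          rw [NNReal.smul_def, Real.coe_toNNReal _ (by positivity)]
        · exact (measurable_subtype_coe.pow_const _).real_toNNReal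

/-- The integral of `g` over the unit sphere dilated by `r`. -/
noncomputable def sphericalIntegral (g : V → ℂ) (r : ℝ) : ℂ :=
  ∫ ω : sphere (0 : V) 1, g (r • (ω : V)) ∂(volume : Measure V).toSphere

theorem continuous_sphericalIntegral {g : V → ℂ} (hg : Continuous g) :
    Continuous (sphericalIntegral g) := by
  have : Continuous (Function.uncurry fun (r : ℝ) (ω : sphere (0 : V) 1) => g (r • (ω : V))) := by
    simp only [Function.uncurry_def]
    fun_prop
  have h := continuous_parametric_integral_of_continuous
    (μ := (volume : Measure V).toSphere) this (s := univ) isCompact_univ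
  simp only [Measure.restrict_univ] at h
  exact h

theorem sphericalIntegral_zero (g : V → ℂ) :
    sphericalIntegral g 0 = (volume : Measure V).toSphere.real univ * g 0 := by
  simp [sphericalIntegral]

theorem integral_mul_norm_cpow_eq_mellin [Nontrivial V] {g : V → ℂ} {β : ℂ}
    (hg : Integrable fun w => g w * (‖w‖ : ℂ) ^ (β - Module.finrank ℝ V)) :
    ∫ w, g w * (‖w‖ : ℂ) ^ (β - Module.finrank ℝ V) = mellin (sphericalIntegral g) β := by
  rw [integral_eq_integral_Ioi_integral_sphere hg, mellin]
  refine setIntegral_congr_fun measurableSet_Ioi fun r hr => ?_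
  have hr' : (0 : ℝ) < r := hr
  have hrc : (r : ℂ) ≠ 0 := by exact_mod_cast hr'.ne'
  have hd : 0 < Module.finrank ℝ V := Module.finrank_pos
  have h1 : ∀ ω : sphere (0 : V) 1, ‖r • (ω : V)‖ = r := fun ω => by
    rw [norm_smul, Real.norm_of_nonneg hr'.le, norm_eq_of_mem_sphere, mul_one]
  simp only [h1]
  rw [integral_mul_const, sphericalIntegral, Complex.real_smul, smul_eq_mul]
  have : (r : ℂ) ^ (β - 1) =
      ((r ^ (Module.finrank ℝ V - 1) : ℝ) : ℂ) * (r : ℂ) ^ (β - Module.finrank ℝ V) := by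
    rw [Complex.ofReal_pow, ← Complex.cpow_natCast, ← Complex.cpow_add _ _ hrc, Nat.cast_sub hd]
    congr 1
    push_cast
    ring
  rw [this]; ring

theorem norm_sphericalIntegral_le {g : V → ℂ} {r B : ℝ}
    (h : ∀ ω : sphere (0 : V) 1, ‖g (r • (ω : V))‖ ≤ B) :
    ‖sphericalIntegral g r‖ ≤ B * (volume : Measure V).toSphere.real univ :=
  norm_integral_le_of_norm_le_const (Eventually.of_forall h)

theorem isBigO_sphericalIntegral_atTop {g : V → ℂ} {c C : ℝ} (hc : 0 ≤ c)
    (hg : ∀ w, ‖g w‖ ≤ C * (1 + ‖w‖) ^ (-c)) :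
    sphericalIntegral g =O[atTop] fun r => r ^ (-c) := by
  refine IsBigO.trans ?_ (isBigO_one_add_rpow_neg_atTop hc)
  refine IsBigO.of_bound (C * (volume : Measure V).toSphere.real univ) ?_
  filter_upwards [eventually_gt_atTop 0] with r hr
  rw [Real.norm_of_nonneg (by positivity)]
  refine (norm_sphericalIntegral_le (B := C * (1 + r) ^ (-c)) fun ω => ?_).trans (le_of_eq (by ring))
  have h := hg (r • (ω : V))
  rwa [norm_smul, Real.norm_of_nonneg hr.le, norm_eq_of_mem_sphere, mul_one] at h

theorem isBigO_sphericalIntegral_sub {g : V → ℂ} (hg : Continuous g) {ε M ρ : ℝ} (hρ : 0 < ρ)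
    (h : ∀ w, ‖w‖ < ρ → ‖g w - g 0‖ ≤ M * ‖w‖ ^ ε) :
    (fun r => sphericalIntegral g r - sphericalIntegral g 0) =O[𝓝[>] 0] fun r : ℝ => r ^ ε := by
  refine IsBigO.of_bound (M * (volume : Measure V).toSphere.real univ) ?_
  filter_upwards [Ioo_mem_nhdsGT hρ] with r hr
  have hr0 : 0 < r := hr.1
  rw [Real.norm_of_nonneg (by positivity)]
  have hi : ∀ s : ℝ, Integrable (fun ω : sphere (0 : V) 1 => g (s • (ω : V)))
      (volume : Measure V).toSphere := fun s => by
    have hcs : Continuous fun ω : sphere (0 : V) 1 => g (s • (ω : V)) := by fun_prop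
    exact hcs.integrable_of_hasCompactSupport (HasCompactSupport.of_compactSpace _)
  have h1 : sphericalIntegral g r - sphericalIntegral g 0 =
      sphericalIntegral (fun w => g w - g 0) r := by
    simp only [sphericalIntegral]
    rw [← integral_sub (hi r) (hi 0)]
    simp
  rw [h1]
  refine (norm_sphericalIntegral_le (B := M * r ^ ε) fun ω => ?_).trans (le_of_eq (by ring))
  have hn : ‖r • (ω : V)‖ = r := by
    rw [norm_smul, Real.norm_of_nonneg hr0.le, norm_eq_of_mem_sphere, mul_one]
  have h2 := h (r • (ω : V)) (by rw [hn]; exact hr.2)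
  rwa [hn] at h2

/-- The spherical integral with its value at the origin removed on the unit interval. -/
noncomputable def regularizedSphericalIntegral (g : V → ℂ) (r : ℝ) : ℂ :=
  sphericalIntegral g r - (Ioc 0 1).indicator (fun _ => (1 : ℂ)) r • sphericalIntegral g 0

theorem differentiableAt_mellin_regularizedSphericalIntegral {g : V → ℂ} (hg : Continuous g)
    {c C ε M ρ : ℝ} (hc : 0 ≤ c) (hgc : ∀ w, ‖g w‖ ≤ C * (1 + ‖w‖) ^ (-c)) (hρ : 0 < ρ)
    (h : ∀ w, ‖w‖ < ρ → ‖g w - g 0‖ ≤ M * ‖w‖ ^ ε) {β : ℂ} (hβ : -ε < β.re) (hβc : β.re < c) :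
    DifferentiableAt ℂ (mellin (regularizedSphericalIntegral g)) β := by
  have hm := continuous_sphericalIntegral hg
  refine mellin_differentiableAt_of_isBigO_rpow (a := c) (b := -ε) ?_ ?_ hβc ?_ hβ
  · refine LocallyIntegrableOn.sub (hm.locallyIntegrable.locallyIntegrableOn _) ?_
    refine LocallyIntegrable.locallyIntegrableOn (Integrable.locallyIntegrable ?_) _
    refine Integrable.smul_const ?_ _
    exact (integrable_indicator_iff measurableSet_Ioc).2 (integrableOn_const (by simp))
  · refine (isBigO_sphericalIntegral_atTop hc hgc).congr' ?_ EventuallyEq.rfl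
    filter_upwards [eventually_gt_atTop 1] with r hr
    simp [regularizedSphericalIntegral, hr.not_ge]
  · rw [neg_neg]
    refine (isBigO_sphericalIntegral_sub hg hρ h).congr' ?_ EventuallyEq.rfl
    filter_upwards [Ioo_mem_nhdsGT (zero_lt_one' ℝ)] with r hr
    simp [regularizedSphericalIntegral, hr.1, hr.2.le]

theorem mellin_sphericalIntegral {g : V → ℂ} (hg : Continuous g)
    {c C : ℝ} (hgc : ∀ w, ‖g w‖ ≤ C * (1 + ‖w‖) ^ (-c)) {β : ℂ} (hβ : 0 < β.re)
    (hβc : β.re < c) :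
    mellin (sphericalIntegral g) β =
      mellin (regularizedSphericalIntegral g) β + sphericalIntegral g 0 / β := by
  have hm := continuous_sphericalIntegral hg
  have h1 : MellinConvergent (sphericalIntegral g) β := by
    refine mellinConvergent_of_isBigO_rpow (a := c) (b := 0)
      (hm.locallyIntegrable.locallyIntegrableOn _)
      (isBigO_sphericalIntegral_atTop (by linarith) hgc) hβc ?_ hβ
    have h2 := (hm.tendsto 0).isBigO_one ℝ
    simpa using h2.mono nhdsWithin_le_nhds
  have h2 := hasMellin_one_Ioc hβ
  have h3 : HasMellin (fun r => (Ioc 0 1).indicator (fun _ => (1 : ℂ)) r • sphericalIntegral g 0) β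
      (sphericalIntegral g 0 / β) := by
    have := hasMellin_const_smul h2.1 (sphericalIntegral g 0)
    rw [h2.2] at this
    rw [smul_eq_mul, mul_one_div] at this
    simpa only [smul_eq_mul, mul_comm] using this
  have h4 := (hasMellin_sub h1 h3.1).2
  rw [h3.2] at h4
  unfold regularizedSphericalIntegral
  rw [h4]; ring

end Polar

theorem toSphere_real_univ_euclideanSpace (n : ℕ) [Nonempty (Fin n)] :
    (volume : Measure (EuclideanSpace ℝ (Fin n))).toSphere.real univ =
      2 * Real.pi ^ ((n : ℝ) / 2) / Real.Gamma ((n : ℝ) / 2) := by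
  have hn : 0 < n := Fin.pos_iff_nonempty.2 inferInstance
  have hn2 : (n : ℝ) / 2 ≠ 0 := by positivity
  have hΓ : 0 < Real.Gamma ((n : ℝ) / 2) := Real.Gamma_pos_of_pos (by positivity)
  rw [Measure.toSphere_real_apply_univ, measureReal_def, EuclideanSpace.volume_ball,
    finrank_euclideanSpace, Fintype.card_fin, Real.Gamma_add_one hn2, ENNReal.ofReal_one, one_pow,
    one_mul, ENNReal.toReal_ofReal (by positivity), Real.sqrt_eq_rpow, ← Real.rpow_natCast,
    ← Real.rpow_mul Real.pi_pos.le, one_div_mul_eq_div]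
  field_simp

theorem inv_Hfun (n : ℕ) (β : ℂ) :
    (Hfun n β)⁻¹ = Complex.Gamma ((n - β) / 2) * ((2 : ℂ) ^ β * (Real.pi : ℂ) ^ ((n : ℂ) / 2))⁻¹ *
      (Complex.Gamma (β / 2))⁻¹ := by
  rw [Hfun, inv_div, mul_inv, div_eq_mul_inv, mul_inv, mul_inv]
  ring

/-- The holomorphic continuation of `β ↦ (I^β f)(x)`. -/
noncomputable def rieszContinuation (n : ℕ) (f : EuclideanSpace ℝ (Fin n) → ℂ)
    (x : EuclideanSpace ℝ (Fin n)) (β : ℂ) : ℂ :=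
  Complex.Gamma ((n - β) / 2) * ((2 : ℂ) ^ β * (Real.pi : ℂ) ^ ((n : ℂ) / 2))⁻¹ *
    ((Complex.Gamma (β / 2))⁻¹ * mellin (regularizedSphericalIntegral fun w => f (x - w)) β +
      sphericalIntegral (fun w => f (x - w)) 0 / 2 * (Complex.Gamma (β / 2 + 1))⁻¹)

section Continuation

variable {n : ℕ} {f : EuclideanSpace ℝ (Fin n) → ℂ}

theorem rieszContinuation_zero [Nonempty (Fin n)] (x : EuclideanSpace ℝ (Fin n)) :
    rieszContinuation n f x 0 = f x := by
  have hn : 0 < n := Fin.pos_iff_nonempty.2 inferInstance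
  have hΓ : 0 < Real.Gamma ((n : ℝ) / 2) := Real.Gamma_pos_of_pos (by positivity)
  have hΓc : (Real.Gamma ((n : ℝ) / 2) : ℂ) ≠ 0 := by exact_mod_cast hΓ.ne'
  have h1 : Complex.Gamma ((n : ℂ) / 2) = (Real.Gamma ((n : ℝ) / 2) : ℂ) := by
    rw [← Complex.Gamma_ofReal]; push_cast; rfl
  have h2 : (Real.pi : ℂ) ^ ((n : ℂ) / 2) = ((Real.pi ^ ((n : ℝ) / 2) : ℝ) : ℂ) := by
    rw [Complex.ofReal_cpow Real.pi_pos.le]; push_cast; rfl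
  have h3 : ((Real.pi ^ ((n : ℝ) / 2) : ℝ) : ℂ) ≠ 0 := by
    have : 0 < Real.pi ^ ((n : ℝ) / 2) := Real.rpow_pos_of_pos Real.pi_pos _
    exact_mod_cast this.ne'
  rw [rieszContinuation, sphericalIntegral_zero, toSphere_real_univ_euclideanSpace]
  simp only [sub_zero, zero_div, Complex.Gamma_zero, inv_zero, zero_mul, zero_add,
    Complex.Gamma_one, inv_one, mul_one, Complex.cpow_zero, one_mul, h1, h2]
  push_cast
  rw [Complex.ofReal_cpow Real.pi_pos.le] at h3
  push_cast at h3
  field_simp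

theorem riesz_eq_rieszContinuation [Nonempty (Fin n)] (hfc : Continuous f) {c C : ℝ} (hC : 0 ≤ C)
    (hf : ∀ y, ‖f y‖ ≤ C * (1 + ‖y‖) ^ (-c)) {β : ℂ} (hβ : 0 < β.re) (hβc : β.re < c)
    (x : EuclideanSpace ℝ (Fin n)) :
    riesz n f β x = rieszContinuation n f x β := by
  have hc : 0 ≤ c := by linarith
  have hg : Continuous fun w => f (x - w) := by fun_prop
  have hgc : ∀ w, ‖f (x - w)‖ ≤ (C * (1 + ‖x‖) ^ c) * (1 + ‖w‖) ^ (-c) := fun w => by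
    calc ‖f (x - w)‖ ≤ C * (1 + ‖x - w‖) ^ (-c) := hf _
      _ ≤ C * ((1 + ‖x‖) ^ c * (1 + ‖w‖) ^ (-c)) := by
          gcongr; exact one_add_norm_sub_rpow_neg_le x w hc
      _ = _ := by ring
  have h1 := integral_mul_norm_cpow_eq_mellin
    (integrable_comp_sub_mul_norm_cpow hfc.measurable hC hf hβ hβc x)
  rw [mellin_sphericalIntegral hg hgc hβ hβc, finrank_euclideanSpace, Fintype.card_fin] at h1
  have h2 := integral_sub_left_eq_self
    (fun w => f (x - w) * (‖w‖ : ℂ) ^ (β - n)) volume x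
  simp only [sub_sub_cancel] at h2
  have hβ0 : β ≠ 0 := fun h => by simp [h] at hβ
  have hβ2 : β / 2 ≠ 0 := div_ne_zero hβ0 two_ne_zero
  rw [riesz, h2, h1, inv_Hfun, rieszContinuation, Complex.Gamma_add_one _ hβ2, mul_inv]
  field_simp

theorem differentiableAt_rieszContinuation (hfc : Continuous f) {c C : ℝ} (hc : 0 ≤ c) (hcn : c ≤ n)
    (hC : 0 ≤ C) (hf : ∀ y, ‖f y‖ ≤ C * (1 + ‖y‖) ^ (-c)) {x : EuclideanSpace ℝ (Fin n)}
    {ε M ρ : ℝ} (hρ : 0 < ρ) (h : ∀ w, ‖w‖ < ρ → ‖f (x - w) - f x‖ ≤ M * ‖w‖ ^ ε)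
    {β : ℂ} (hβ : -ε < β.re) (hβc : β.re < c) :
    DifferentiableAt ℂ (rieszContinuation n f x) β := by
  have hg : Continuous fun w => f (x - w) := by fun_prop
  have hgc : ∀ w, ‖f (x - w)‖ ≤ (C * (1 + ‖x‖) ^ c) * (1 + ‖w‖) ^ (-c) := fun w => by
    calc ‖f (x - w)‖ ≤ C * (1 + ‖x - w‖) ^ (-c) := hf _
      _ ≤ C * ((1 + ‖x‖) ^ c * (1 + ‖w‖) ^ (-c)) := by
          gcongr; exact one_add_norm_sub_rpow_neg_le x w hc
      _ = _ := by ring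
  have h1 := differentiableAt_mellin_regularizedSphericalIntegral hg hc hgc hρ
    (by simpa only [sub_zero] using h) hβ hβc
  have hpi : (Real.pi : ℂ) ≠ 0 := by exact_mod_cast Real.pi_ne_zero
  have h2 : DifferentiableAt ℂ (fun β : ℂ => Complex.Gamma ((n - β) / 2)) β := by
    refine DifferentiableAt.comp β (Complex.differentiableAt_Gamma _ fun m hm => ?_) (by fun_prop)
    have h3 := congrArg Complex.re hm
    have h4 : (((n : ℂ) - β) / 2).re = (n - β.re) / 2 := by simp
    rw [h4] at h3
    simp only [Complex.neg_re, Complex.natCast_re] at h3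
    have : (0 : ℝ) ≤ m := Nat.cast_nonneg m
    linarith
  have h3 : DifferentiableAt ℂ (fun β : ℂ => ((2 : ℂ) ^ β * (Real.pi : ℂ) ^ ((n : ℂ) / 2))⁻¹) β := by
    refine DifferentiableAt.inv ?_ ?_
    · exact (DifferentiableAt.const_cpow differentiableAt_id (Or.inl two_ne_zero)).mul_const _
    · exact mul_ne_zero (fun h => two_ne_zero ((Complex.cpow_eq_zero_iff _ _).1 h).1)
        (fun h => hpi ((Complex.cpow_eq_zero_iff _ _).1 h).1)
  have h4 : DifferentiableAt ℂ (fun β : ℂ => (Complex.Gamma (β / 2))⁻¹) β :=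
    DifferentiableAt.comp (g := fun s => (Complex.Gamma s)⁻¹) (f := fun β : ℂ => β / 2) β
      (Complex.differentiable_one_div_Gamma (β / 2)) (by fun_prop)
  have h5 : DifferentiableAt ℂ (fun β : ℂ => (Complex.Gamma (β / 2 + 1))⁻¹) β :=
    DifferentiableAt.comp (g := fun s => (Complex.Gamma s)⁻¹) (f := fun β : ℂ => β / 2 + 1) β
      (Complex.differentiable_one_div_Gamma (β / 2 + 1)) (by fun_prop)
  exact (h2.mul h3).mul ((h4.mul h1).add (h5.const_mul _))

end Continuation

theorem stmt_12 (n k : ℕ) (hk1 : 1 ≤ k) (hkn : k < n) (δ : ℝ) (hδ0 : 0 < δ) (hδ1 : δ < 1)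
    (f : EuclideanSpace ℝ (Fin n) → ℂ) (hfc : Continuous f)
    (hdecay : f =O[cocompact (EuclideanSpace ℝ (Fin n))] fun y => ‖y‖ ^ (-((k : ℝ) + δ)))
    (hHolder : ∀ z : EuclideanSpace ℝ (Fin n),
      ∃ (U : Set (EuclideanSpace ℝ (Fin n))) (ε : ℝ) (M : ℝ), IsOpen U ∧ z ∈ U ∧
        0 < ε ∧ ε < 1 ∧
        ∀ x₁ ∈ U, ∀ x₂ ∈ U, ‖f x₁ - f x₂‖ ≤ M * ‖x₁ - x₂‖ ^ ε) :
    ∀ x : EuclideanSpace ℝ (Fin n),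
      (∀ y : EuclideanSpace ℝ (Fin n),
        Integrable (fun z => f z * (‖y - z‖ : ℂ) ^ ((k : ℂ) - n))) ∧
      ∃ η : ℝ, 0 < η ∧
        ∃ F : ℂ → ℂ,
          DifferentiableOn ℂ F {α : ℂ | -(k : ℝ) - η < α.re ∧ α.re < δ} ∧
          (∀ α : ℂ, 0 < α.re → α.re < δ → F α = riesz n (riesz n f k) α x) ∧
          F (-(k : ℂ)) = f x := by
  have hk : (1 : ℝ) ≤ k := by exact_mod_cast hk1
  have hkn' : (k : ℝ) + 1 ≤ n := by exact_mod_cast hkn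
  have hc : 0 ≤ (k : ℝ) + δ := by positivity
  have : Nonempty (Fin n) := ⟨⟨0, by omega⟩⟩
  obtain ⟨C, hC, hf⟩ := exists_norm_le_mul_one_add_norm_rpow_neg hfc hc hdecay
  intro x
  constructor
  · intro y
    have h := integrable_mul_norm_sub_cpow hfc.measurable hC hf (β := k) (by simp; omega)
      (by simpa using hδ0) y
    rwa [finrank_euclideanSpace, Fintype.card_fin] at h
  · obtain ⟨U, ε, M, hU, hxU, hε0, -, hM⟩ := hHolder x
    obtain ⟨ρ, hρ, hball⟩ := Metric.isOpen_iff.1 hU x hxU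
    refine ⟨ε, hε0, fun α => rieszContinuation n f x (α + k), ?_, ?_, ?_⟩
    · rintro α ⟨h1, h2⟩
      refine DifferentiableAt.differentiableWithinAt ?_
      have hd : DifferentiableAt ℂ (rieszContinuation n f x) (α + k) := by
        refine differentiableAt_rieszContinuation hfc hc (by linarith) hC hf hρ (ε := ε) (M := M)
          (fun w hw => ?_) ?_ ?_
        · have h3 := hM (x - w) (hball (by simpa using hw)) x hxU
          rwa [sub_sub_cancel_left, norm_neg] at h3
        · simp only [Complex.add_re, Complex.natCast_re]; linarith
        · simp only [Complex.add_re, Complex.natCast_re]; linarith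
      exact DifferentiableAt.comp (g := rieszContinuation n f x) (f := fun α : ℂ => α + k) α hd
        (by fun_prop)
    · intro α hα0 hαδ
      have hre : (α + k).re = α.re + k := by simp
      rw [riesz_riesz hfc.measurable hC hf hα0 (by simp; omega) (by rw [hre]; linarith)
        (by rw [hre]; linarith), riesz_eq_rieszContinuation hfc hC hf
        (by rw [hre]; linarith) (by rw [hre]; linarith)]
    · simp only [neg_add_cancel]
      exact rieszContinuation_zero x
end

section
/- Let a > 0 and let f : ℝ → ℂ be continuous with f(x) = O(|x|^{-a}) as |x| → ∞. Then the limit along real s of x_+^s(f) = (1/Γ(s+1)) ∫₀^∞ f(x) x^s dx as s → -1⁺ exists and equals f(0), i.e. lim_{s → -1⁺} (1/Γ(s+1)) ∫₀^∞ f(x) x^s dx = f(0). -/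
open Complex MeasureTheory Filter Asymptotics Set

/-- `x₊^α(f) = (1/Γ(α+1)) ∫₀^∞ f(x) x^α dx`. -/
noncomputable def xplus (f : ℝ → ℂ) (α : ℂ) : ℂ :=
  (Complex.Gamma (α + 1))⁻¹ * ∫ x in Set.Ioi (0 : ℝ), f x * (x : ℂ) ^ α

theorem exists_norm_mul_max_rpow_le {a : ℝ} (ha : 0 < a) {f : ℝ → ℂ} (hfc : Continuous f)
    (hdecay : f =O[cocompact ℝ] fun x => |x| ^ (-a)) :
    ∃ C : ℝ, ∀ x, ‖f x‖ * max 1 |x| ^ a ≤ C := by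
  obtain ⟨c, hc⟩ := hdecay.bound
  obtain ⟨K, hK, hKc⟩ := mem_cocompact.1 hc
  have hcont : Continuous fun x : ℝ => ‖f x‖ * max 1 |x| ^ a :=
    hfc.norm.mul ((continuous_const.max continuous_abs).rpow_const fun _ => Or.inr ha.le)
  obtain ⟨M, hM⟩ := (hK.union (isCompact_closedBall (0 : ℝ) 1)).bddAbove_image hcont.continuousOn
  refine ⟨max M c, fun x => ?_⟩
  by_cases hx : x ∈ K ∪ Metric.closedBall (0 : ℝ) 1
  · exact le_max_of_le_left (hM ⟨x, hx, rfl⟩)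
  · simp only [mem_union, Metric.mem_closedBall, dist_zero_right, Real.norm_eq_abs, not_or,
      not_le] at hx
    have hx0 : 0 < |x| := one_pos.trans hx.2
    have hfx : ‖f x‖ ≤ c * ‖|x| ^ (-a)‖ := hKc hx.1
    rw [Real.norm_of_nonneg (by positivity)] at hfx
    refine le_max_of_le_right ?_
    rw [max_eq_right hx.2.le]
    calc ‖f x‖ * |x| ^ a ≤ c * |x| ^ (-a) * |x| ^ a := by gcongr
      _ = c := by rw [mul_assoc, ← Real.rpow_add hx0]; simp

theorem tendsto_rpow_inv_nhdsGT_zero_of_lt_one {u : ℝ} (hu0 : 0 < u) (hu1 : u < 1) :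
    Tendsto (fun t : ℝ => u ^ t⁻¹) (nhdsWithin 0 (Ioi 0)) (nhds 0) :=
  (tendsto_rpow_atTop_of_base_lt_one u (by linarith) hu1).comp tendsto_inv_nhdsGT_zero

theorem tendsto_rpow_inv_nhdsGT_zero_of_one_lt {u : ℝ} (hu : 1 < u) :
    Tendsto (fun t : ℝ => u ^ t⁻¹) (nhdsWithin 0 (Ioi 0)) atTop := by
  simp_rw [Real.rpow_def_of_pos (one_pos.trans hu)]
  exact Real.tendsto_exp_atTop.comp (tendsto_inv_nhdsGT_zero.const_mul_atTop (Real.log_pos hu))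

/-- After the substitution `u = x ^ t`, the integrals `t ∫₀^∞ f(x) x^(t-1) dx` converge to `f 0`. -/
theorem tendsto_integral_comp_rpow_inv {a : ℝ} (ha : 0 < a) {f : ℝ → ℂ} (hfc : Continuous f)
    (hdecay : f =O[cocompact ℝ] fun x => |x| ^ (-a)) :
    Tendsto (fun t : ℝ => ∫ u in Ioi (0 : ℝ), f (u ^ t⁻¹)) (nhdsWithin 0 (Ioi 0))
      (nhds (f 0)) := by
  obtain ⟨C, hC⟩ := exists_norm_mul_max_rpow_le ha hfc hdecay
  have hC0 : 0 ≤ C := le_trans (by positivity) (hC 0)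
  have hlim : ∫ u in Ioi (0 : ℝ), (Iio (1 : ℝ)).indicator (fun _ => f 0) u = f 0 := by
    rw [setIntegral_indicator measurableSet_Iio, Ioi_inter_Iio, setIntegral_const]
    simp
  have hf0 : Tendsto f atTop (nhds 0) := by
    refine (hdecay.mono atTop_le_cocompact).trans_tendsto ?_
    exact (tendsto_rpow_neg_atTop ha).comp tendsto_abs_atTop_atTop
  have key : Tendsto (fun t : ℝ => ∫ u in Ioi (0 : ℝ), f (u ^ t⁻¹)) (nhdsWithin 0 (Ioi 0))
      (nhds (∫ u in Ioi (0 : ℝ), (Iio (1 : ℝ)).indicator (fun _ => f 0) u)) := by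
    refine tendsto_integral_filter_of_dominated_convergence
      (fun u => 2 * C * (1 + u ^ 2)⁻¹) ?_ ?_ (integrable_inv_one_add_sq.const_mul _).restrict ?_
    · refine Eventually.of_forall fun t => ?_
      exact (hfc.measurable.comp (measurable_id.pow_const t⁻¹)).aestronglyMeasurable
    · filter_upwards [Ioo_mem_nhdsGT (half_pos ha)] with t ht
      filter_upwards [ae_restrict_mem measurableSet_Ioi] with u hu
      have hu : 0 < u := hu
      have hx : 0 < u ^ t⁻¹ := Real.rpow_pos_of_pos hu _
      have hCu := hC (u ^ t⁻¹)
      rw [abs_of_pos hx] at hCu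
      have hone : 1 ≤ max 1 (u ^ t⁻¹) ^ a := Real.one_le_rpow (le_max_left _ _) ha.le
      have hmax : 1 + u ^ 2 ≤ 2 * max 1 (u ^ t⁻¹) ^ a := by
        rcases le_total u 1 with h1 | h1
        · nlinarith
        · have : u ^ 2 ≤ max 1 (u ^ t⁻¹) ^ a := by
            calc u ^ 2 = u ^ (2 : ℝ) := (Real.rpow_two u).symm
              _ ≤ u ^ (t⁻¹ * a) := by
                refine Real.rpow_le_rpow_of_exponent_le h1 ?_
                rw [inv_mul_eq_div, le_div_iff₀ ht.1]
                linarith [ht.2]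
              _ = (u ^ t⁻¹) ^ a := Real.rpow_mul hu.le _ _
              _ ≤ max 1 (u ^ t⁻¹) ^ a :=
                Real.rpow_le_rpow hx.le (le_max_right _ _) ha.le
          linarith
      rw [← div_eq_mul_inv, le_div_iff₀ (by positivity)]
      calc ‖f (u ^ t⁻¹)‖ * (1 + u ^ 2) ≤ ‖f (u ^ t⁻¹)‖ * (2 * max 1 (u ^ t⁻¹) ^ a) := by gcongr
        _ ≤ 2 * C := by linarith
    · filter_upwards [ae_restrict_mem measurableSet_Ioi,
        ae_restrict_of_ae (Measure.ae_ne volume (1 : ℝ))] with u hu hu1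
      rcases lt_or_gt_of_ne hu1 with h | h
      · rw [indicator_of_mem (show u ∈ Iio 1 from h)]
        exact (hfc.tendsto 0).comp (tendsto_rpow_inv_nhdsGT_zero_of_lt_one hu h)
      · rw [indicator_of_notMem (show u ∉ Iio 1 from not_lt.2 h.le)]
        exact hf0.comp (tendsto_rpow_inv_nhdsGT_zero_of_one_lt h)
  rwa [hlim] at key

theorem xplus_sub_one_eq (f : ℝ → ℂ) {t : ℝ} (ht : 0 < t) :
    xplus f ((t - 1 : ℝ) : ℂ) =
      (Complex.Gamma ((t : ℂ) + 1))⁻¹ * ∫ u in Ioi (0 : ℝ), f (u ^ t⁻¹) := by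
  have ht' : (t : ℂ) ≠ 0 := by exact_mod_cast ht.ne'
  have hsub : ∫ u in Ioi (0 : ℝ), f (u ^ t⁻¹) =
      t * ∫ x in Ioi (0 : ℝ), f x * (x : ℂ) ^ ((t - 1 : ℝ) : ℂ) := by
    rw [← integral_comp_rpow_Ioi (fun u => f (u ^ t⁻¹)) ht.ne', ← integral_const_mul]
    refine setIntegral_congr_fun measurableSet_Ioi fun x hx => ?_
    have hx : 0 < x := hx
    simp only [Real.rpow_rpow_inv hx.le ht.ne', abs_of_pos ht, Complex.real_smul,
      Complex.ofReal_mul, Complex.ofReal_cpow hx.le]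
    ring
  rw [hsub, Complex.Gamma_add_one _ ht', xplus]
  push_cast
  rw [sub_add_cancel, mul_inv]
  field_simp

theorem stmt_13 (a : ℝ) (ha : 0 < a)
    (f : ℝ → ℂ) (hfc : Continuous f)
    (hdecay : f =O[cocompact ℝ] fun x => |x| ^ (-a)) :
    Tendsto (fun s : ℝ => xplus f (s : ℂ)) (nhdsWithin (-1) (Set.Ioi (-1))) (nhds (f 0)) := by
  have hshift : Tendsto (fun s : ℝ => s + 1) (nhdsWithin (-1) (Ioi (-1)))
      (nhdsWithin 0 (Ioi 0)) := by
    refine tendsto_nhdsWithin_iff.2 ⟨?_, ?_⟩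
    · have h : Continuous fun s : ℝ => s + 1 := by fun_prop
      simpa using (h.tendsto (-1)).mono_left nhdsWithin_le_nhds
    · filter_upwards [self_mem_nhdsWithin] with s hs
      have hs : -1 < s := hs
      exact mem_Ioi.2 (by linarith)
  have hGamma : Tendsto (fun t : ℝ => (Complex.Gamma ((t : ℂ) + 1))⁻¹)
      (nhdsWithin 0 (Ioi 0)) (nhds 1) := by
    have h : Continuous fun t : ℝ => (Complex.Gamma ((t : ℂ) + 1))⁻¹ :=
      Complex.differentiable_one_div_Gamma.continuous.comp (by fun_prop)
    simpa using (h.tendsto 0).mono_left nhdsWithin_le_nhds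
  have hlim := (hGamma.mul (tendsto_integral_comp_rpow_inv ha hfc hdecay)).comp hshift
  rw [one_mul] at hlim
  refine hlim.congr' ?_
  filter_upwards [self_mem_nhdsWithin] with s hs
  have hs : -1 < s := hs
  simpa using (xplus_sub_one_eq f (t := s + 1) (by linarith)).symm
end

section
/- Let a > 0, n ∈ ℕ, x ∈ ℝⁿ, and let f : ℝⁿ → ℂ be continuous with f(x) = O(|x|^{-a}). Then the limit along real s of (I^s f)(x) = (1/H_n(s)) ∫_{ℝⁿ} f(y)|x - y|^{s-n} dy as s → 0⁺ exists and equals f(x), i.e. lim_{s → 0⁺} (1/H_n(s)) ∫_{ℝⁿ} f(y)|x - y|^{s-n} dy = f(x). -/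
open Complex MeasureTheory Filter Asymptotics Set Metric

section NormPowers

open Module

variable {E : Type*} [NormedAddCommGroup E] [NormedSpace ℝ E]

theorem norm_rpow_smul_le {g : E → ℂ} {a C : ℝ}
    (hC : ∀ z : E, 1 ≤ ‖z‖ → ‖g z‖ ≤ C * ‖z‖ ^ (-a)) {s : ℝ} (hs : s ≤ a / 2) {z : E}
    (hz : 1 ≤ ‖z‖) :
    ‖‖z‖ ^ (s - finrank ℝ E) • g z‖ ≤ C * ‖z‖ ^ (-(finrank ℝ E + a / 2)) := by
  have hz0 : 0 < ‖z‖ := by linarith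
  rw [norm_smul, Real.norm_of_nonneg (by positivity)]
  calc ‖z‖ ^ (s - finrank ℝ E) * ‖g z‖
      ≤ ‖z‖ ^ (a / 2 - finrank ℝ E) * (C * ‖z‖ ^ (-a)) := by
        gcongr
        exact hC z hz
    _ = C * (‖z‖ ^ (a / 2 - finrank ℝ E) * ‖z‖ ^ (-a)) := by ring
    _ = C * ‖z‖ ^ (-(finrank ℝ E + a / 2)) := by
        rw [← Real.rpow_add hz0]
        congr 2
        ring

variable [FiniteDimensional ℝ E]

theorem pow_finrank_sub_one_mul_rpow [Nontrivial E] {s t : ℝ} (ht : 0 < t) :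
    t ^ (finrank ℝ E - 1) * t ^ (s - finrank ℝ E) = t ^ (s - 1) := by
  have hd : 1 ≤ finrank ℝ E := finrank_pos
  rw [← Real.rpow_natCast, ← Real.rpow_add ht, Nat.cast_sub hd]
  congr 1
  push_cast
  ring

theorem exists_norm_comp_sub_left_le_of_isBigO_cocompact {F : Type*} [NormedAddCommGroup F]
    {f : E → F} {a : ℝ} (ha : 0 < a) (hfc : Continuous f)
    (hf : f =O[cocompact E] fun y => ‖y‖ ^ (-a)) (x : E) :
    ∃ C : ℝ, ∀ z : E, 1 ≤ ‖z‖ → ‖f (x - z)‖ ≤ C * ‖z‖ ^ (-a) := by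
  have hlim : Tendsto (fun z : E => x - z) (cocompact E) (cocompact E) :=
    (Homeomorph.subLeft x).isClosedEmbedding.tendsto_cocompact
  obtain ⟨c, hc0, hc⟩ := (hf.comp_tendsto hlim).exists_pos
  have hlarge : ∀ᶠ z : E in cocompact E, 2 * ‖x‖ + 1 ≤ ‖z‖ :=
    (tendsto_norm_cocompact_atTop (E := E)).eventually_ge_atTop _
  have hev : ∀ᶠ z : E in cocompact E, ‖f (x - z)‖ * ‖z‖ ^ a ≤ c * 2 ^ a := by
    filter_upwards [hc.bound, hlarge] with z h1 h2
    have hx := norm_nonneg x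
    have hz : 0 < ‖z‖ := by linarith
    have hhalf : ‖z‖ / 2 ≤ ‖x - z‖ := by
      have := norm_sub_norm_le z x
      rw [norm_sub_rev] at this
      linarith
    have hxz : 0 < ‖x - z‖ := by linarith
    simp only [Function.comp_apply, Real.norm_eq_abs,
      abs_of_pos (Real.rpow_pos_of_pos hxz (-a))] at h1
    have hratio : ‖x - z‖ ^ (-a) * ‖z‖ ^ a ≤ 2 ^ a := by
      rw [Real.rpow_neg hxz.le, inv_mul_eq_div, ← Real.div_rpow hz.le hxz.le]
      refine Real.rpow_le_rpow (by positivity) ?_ ha.le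
      rw [div_le_iff₀ hxz]
      linarith
    calc ‖f (x - z)‖ * ‖z‖ ^ a ≤ c * ‖x - z‖ ^ (-a) * ‖z‖ ^ a := by gcongr
      _ = c * (‖x - z‖ ^ (-a) * ‖z‖ ^ a) := by ring
      _ ≤ c * 2 ^ a := by gcongr
  obtain ⟨K, hK, hKc⟩ := Filter.mem_cocompact.1 hev
  have hcont : Continuous fun z : E => ‖f (x - z)‖ * ‖z‖ ^ a :=
    (by fun_prop : Continuous fun z : E => ‖f (x - z)‖).mul
      (continuous_norm.rpow_const fun _ => Or.inr ha.le)
  obtain ⟨M, hM⟩ := hK.bddAbove_image hcont.continuousOn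
  refine ⟨max M (c * 2 ^ a), fun z hz => ?_⟩
  have hz0 : 0 < ‖z‖ := by linarith
  rw [Real.rpow_neg hz0.le, ← div_eq_mul_inv, le_div_iff₀ (Real.rpow_pos_of_pos hz0 a)]
  by_cases hzK : z ∈ K
  · exact (hM (mem_image_of_mem _ hzK)).trans (le_max_left _ _)
  · exact (hKc hzK : ‖f (x - z)‖ * ‖z‖ ^ a ≤ c * 2 ^ a).trans (le_max_right _ _)

variable [MeasurableSpace E] [BorelSpace E] (μ : Measure E) [μ.IsAddHaarMeasure]

theorem integrableOn_norm_rpow_compl_ball {r : ℝ} (hr : (finrank ℝ E : ℝ) < r) :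
    IntegrableOn (fun z : E => ‖z‖ ^ (-r)) (ball 0 1)ᶜ μ := by
  have hr0 : 0 < r := (Nat.cast_nonneg _).trans_lt hr
  refine (((integrable_one_add_norm (μ := μ) hr).const_mul (2 ^ r)).integrableOn).mono'
    (Measurable.aestronglyMeasurable (by fun_prop)) ?_
  filter_upwards [self_mem_ae_restrict measurableSet_ball.compl] with z hz
  have hz1 : 1 ≤ ‖z‖ := by simpa using hz
  rw [Real.norm_of_nonneg (by positivity), Real.rpow_neg (by positivity),
    Real.rpow_neg (by positivity), ← div_eq_mul_inv,
    ← Real.div_rpow (by positivity) (by positivity), ← Real.inv_rpow (by positivity)]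
  refine Real.rpow_le_rpow (by positivity) ?_ hr0.le
  rw [inv_eq_one_div, div_le_div_iff₀ (by positivity) (by positivity)]
  linarith

variable [Nontrivial E]

theorem integrableOn_norm_rpow_ball {s : ℝ} (hs : 0 < s) :
    IntegrableOn (fun z : E => ‖z‖ ^ (s - finrank ℝ E)) (ball 0 1) μ := by
  refine (integrableOn_fun_norm_addHaar μ (f := fun t : ℝ => t ^ (s - finrank ℝ E))).2 ?_
  have h : IntegrableOn (fun t : ℝ => t ^ (s - 1)) (Ioo 0 1) :=
    ((intervalIntegrable_iff_integrableOn_Ioo_of_le zero_le_one).1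
      (intervalIntegral.intervalIntegrable_rpow' (by linarith)))
  refine h.congr_fun (fun t ht => ?_) measurableSet_Ioo
  exact (pow_finrank_sub_one_mul_rpow ht.1).symm

theorem setIntegral_norm_rpow_ball {s : ℝ} (hs : 0 < s) :
    ∫ z in ball (0 : E) 1, ‖z‖ ^ (s - finrank ℝ E) ∂μ =
      finrank ℝ E * μ.real (ball 0 1) / s := by
  have h1 : ∫ z in ball (0 : E) 1, ‖z‖ ^ (s - finrank ℝ E) ∂μ =
      ∫ z : E, (Iio (1 : ℝ)).indicator (fun t => t ^ (s - finrank ℝ E)) ‖z‖ ∂μ := by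
    rw [← integral_indicator measurableSet_ball]
    congr 1 with z
    simp [indicator]
  have h2 : ∫ t in Ioi (0 : ℝ), t ^ (finrank ℝ E - 1) •
      (Iio (1 : ℝ)).indicator (fun t => t ^ (s - finrank ℝ E)) t = 1 / s := by
    calc _ = ∫ t in Ioi (0 : ℝ), (Iio (1 : ℝ)).indicator (fun t => t ^ (s - 1)) t := by
          refine setIntegral_congr_fun measurableSet_Ioi fun t ht => ?_
          by_cases h : t < 1
          · simp [indicator, h, pow_finrank_sub_one_mul_rpow (E := E) (s := s) (mem_Ioi.1 ht)]
          · simp [indicator, h]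
      _ = ∫ t in (0 : ℝ)..1, t ^ (s - 1) := by
          rw [setIntegral_indicator measurableSet_Iio, Ioi_inter_Iio,
            intervalIntegral.integral_of_le zero_le_one, integral_Ioc_eq_integral_Ioo]
      _ = 1 / s := by
          rw [integral_rpow (Or.inl (by linarith))]
          simp [Real.zero_rpow hs.ne']
  rw [h1, integral_fun_norm_addHaar, h2]
  simp
  ring

theorem tendsto_mul_setIntegral_norm_rpow_ball {g : E → ℂ} (hg : Continuous g) :
    Tendsto (fun s : ℝ => s * ∫ z in ball (0 : E) 1, ‖z‖ ^ (s - finrank ℝ E) • g z ∂μ)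
      (nhdsWithin 0 (Ioi 0)) (nhds ((finrank ℝ E * μ.real (ball (0 : E) 1) : ℝ) * g 0)) := by
  set d : ℝ := (finrank ℝ E : ℝ) with hd
  set κ : ℝ := d * μ.real (ball (0 : E) 1) with hκ
  have hd0 : 0 < d := Nat.cast_pos.2 finrank_pos
  have hκ0 : 0 < κ := mul_pos hd0
    (ENNReal.toReal_pos (measure_ball_pos μ 0 one_pos).ne' measure_ball_lt_top.ne)
  have hpos : ∀ᶠ s : ℝ in nhdsWithin 0 (Ioi 0), 0 < s := self_mem_nhdsWithin
  have hlt : ∀ᶠ s : ℝ in nhdsWithin 0 (Ioi 0), s < d :=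
    nhdsWithin_le_nhds (eventually_lt_nhds hd0)
  have key : Tendsto (fun s : ℝ => ∫ z in ball (0 : E) 1, (s / κ * ‖z‖ ^ (s - d)) • g z ∂μ)
      (nhdsWithin 0 (Ioi 0)) (nhds (g 0)) := by
    refine tendsto_setIntegral_peak_smul_of_integrableOn_of_tendsto (t := ball (0 : E) 1)
      measurableSet_ball measurableSet_ball subset_rfl self_mem_nhdsWithin
      measure_ball_lt_top.ne ?_ ?_ ?_ ?_ ?_ (hg.tendsto 0 |>.mono_left nhdsWithin_le_nhds)
    · filter_upwards [hpos] with s hs z _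
      positivity
    · intro u hu h0u
      obtain ⟨ε, hε, hεu⟩ := Metric.isOpen_iff.1 hu 0 h0u
      rw [Metric.tendstoUniformlyOn_iff]
      intro η hη
      have hlim : Tendsto (fun s : ℝ => s / κ * ε ^ (s - d)) (nhdsWithin 0 (Ioi 0)) (nhds 0) := by
        have : ContinuousAt (fun s : ℝ => s / κ * ε ^ (s - d)) 0 :=
          (by fun_prop : ContinuousAt (fun s : ℝ => s / κ) 0).mul
            (ContinuousAt.rpow continuousAt_const (by fun_prop) (Or.inl hε.ne'))
        simpa using this.tendsto.mono_left nhdsWithin_le_nhds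
      filter_upwards [hpos, hlt, hlim.eventually_lt_const hη] with s hs hsd hsη z hz
      have hεz : ε ≤ ‖z‖ := by
        by_contra! h
        exact hz.2 (hεu (by simpa using h))
      have hle : s / κ * ‖z‖ ^ (s - d) ≤ s / κ * ε ^ (s - d) :=
        mul_le_mul_of_nonneg_left
          (Real.rpow_le_rpow_of_nonpos hε hεz (by linarith)) (by positivity)
      rw [Pi.zero_apply, dist_zero_left, Real.norm_of_nonneg (by positivity)]
      exact hle.trans_lt hsη
    · refine tendsto_const_nhds.congr' ?_
      filter_upwards [hpos] with s hs
      rw [integral_const_mul, setIntegral_norm_rpow_ball μ hs, ← hd, ← hκ]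
      field_simp
    · exact Eventually.of_forall fun s =>
        Measurable.aestronglyMeasurable (by fun_prop)
    · exact (hg.continuousOn.integrableOn_compact (isCompact_closedBall 0 1)).mono_set
        ball_subset_closedBall
  refine (key.const_mul (κ : ℂ)).congr fun s => ?_
  rw [← integral_const_mul, ← integral_const_mul]
  congr 1 with z
  have : (κ : ℂ) ≠ 0 := by exact_mod_cast hκ0.ne'
  simp only [Complex.real_smul, Complex.ofReal_mul, Complex.ofReal_div]
  field_simp

theorem integrableOn_norm_rpow_smul_ball {g : E → ℂ} (hg : Continuous g) {s : ℝ} (hs : 0 < s) :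
    IntegrableOn (fun z : E => ‖z‖ ^ (s - finrank ℝ E) • g z) (ball 0 1) μ := by
  obtain ⟨C, hC⟩ := (isCompact_closedBall (0 : E) 1).exists_bound_of_continuousOn hg.continuousOn
  refine Integrable.smul_of_top_left (integrableOn_norm_rpow_ball μ hs)
    (memLp_top_of_bound hg.aestronglyMeasurable C ?_)
  filter_upwards [self_mem_ae_restrict measurableSet_ball] with z hz
  exact hC z (ball_subset_closedBall hz)

theorem tendsto_mul_integral_norm_rpow {g : E → ℂ} (hg : Continuous g) {a C : ℝ} (ha : 0 < a)
    (hC : ∀ z : E, 1 ≤ ‖z‖ → ‖g z‖ ≤ C * ‖z‖ ^ (-a)) :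
    Tendsto (fun s : ℝ => s * ∫ z, ‖z‖ ^ (s - finrank ℝ E) • g z ∂μ)
      (nhdsWithin 0 (Ioi 0)) (nhds ((finrank ℝ E * μ.real (ball (0 : E) 1) : ℝ) * g 0)) := by
  have hdom : IntegrableOn (fun z : E => C * ‖z‖ ^ (-(finrank ℝ E + a / 2))) (ball 0 1)ᶜ μ :=
    (integrableOn_norm_rpow_compl_ball μ (by linarith)).const_mul C
  have hbound : ∀ {s : ℝ}, s ≤ a / 2 → ∀ᵐ z ∂μ.restrict (ball (0 : E) 1)ᶜ,
      ‖‖z‖ ^ (s - finrank ℝ E) • g z‖ ≤ C * ‖z‖ ^ (-(finrank ℝ E + a / 2)) := fun hs => by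
    filter_upwards [self_mem_ae_restrict measurableSet_ball.compl] with z hz
    exact norm_rpow_smul_le hC hs (by simpa using hz)
  have hsmall : ∀ᶠ s : ℝ in nhdsWithin 0 (Ioi 0), s ≤ a / 2 :=
    nhdsWithin_le_nhds (eventually_le_nhds (half_pos ha))
  have hpos : ∀ᶠ s : ℝ in nhdsWithin 0 (Ioi 0), 0 < s := self_mem_nhdsWithin
  have htail : Tendsto
      (fun s : ℝ => s * ∫ z in (ball (0 : E) 1)ᶜ, ‖z‖ ^ (s - finrank ℝ E) • g z ∂μ)
      (nhdsWithin 0 (Ioi 0)) (nhds 0) := by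
    have hid : Tendsto (fun s : ℝ => (s : ℂ)) (nhdsWithin 0 (Ioi 0)) (nhds 0) :=
      (Complex.continuous_ofReal.tendsto' 0 0 Complex.ofReal_zero).mono_left nhdsWithin_le_nhds
    refine hid.zero_mul_isBoundedUnder_le ?_
    refine isBoundedUnder_of_eventually_le
      (a := ∫ z in (ball (0 : E) 1)ᶜ, C * ‖z‖ ^ (-(finrank ℝ E + a / 2)) ∂μ) ?_
    filter_upwards [hsmall] with s hs
    exact norm_integral_le_of_norm_le hdom (hbound hs)
  have h := (tendsto_mul_setIntegral_norm_rpow_ball μ hg).add htail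
  rw [add_zero] at h
  refine h.congr' ?_
  filter_upwards [hsmall, hpos] with s hs hs0
  rw [← mul_add]
  congr 1
  have hball := integrableOn_norm_rpow_smul_ball μ hg hs0
  have hcompl : IntegrableOn (fun z : E => ‖z‖ ^ (s - finrank ℝ E) • g z) (ball 0 1)ᶜ μ :=
    hdom.mono' (((by fun_prop : Measurable fun z : E => ‖z‖ ^ (s - finrank ℝ E)
      ).aestronglyMeasurable).smul hg.aestronglyMeasurable) (hbound hs)
  refine integral_add_compl measurableSet_ball ?_
  rw [← integrableOn_univ, ← union_compl_self (ball (0 : E) 1)]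
  exact hball.union hcompl

end NormPowers

theorem tendsto_mul_Hfun (n : ℕ) (hn : 0 < n) :
    Tendsto (fun s : ℝ => (s : ℂ) * Hfun n s) (nhdsWithin 0 (Ioi 0))
      (nhds ((n * volume.real (ball (0 : EuclideanSpace ℝ (Fin n)) 1) : ℝ) : ℂ)) := by
  have hn0 : (n : ℂ) ≠ 0 := by exact_mod_cast hn.ne'
  have hcoe : Tendsto (fun s : ℝ => (s : ℂ)) (nhdsWithin 0 (Ioi 0)) (nhdsWithin 0 {0}ᶜ) := by
    refine tendsto_nhdsWithin_iff.2 ⟨?_, ?_⟩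
    · exact (Complex.continuous_ofReal.tendsto' 0 0 Complex.ofReal_zero).mono_left
        nhdsWithin_le_nhds
    · filter_upwards [self_mem_nhdsWithin] with s hs
      simpa using (mem_Ioi.1 hs).ne'
  have hhalf : Tendsto (fun z : ℂ => z / 2) (nhdsWithin 0 {0}ᶜ) (nhdsWithin 0 {0}ᶜ) := by
    refine tendsto_nhdsWithin_iff.2 ⟨?_, ?_⟩
    · exact (Continuous.tendsto' (by fun_prop) 0 0 (by simp)).mono_left nhdsWithin_le_nhds
    · filter_upwards [self_mem_nhdsWithin] with z hz
      simpa using hz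
  have hGamma := Complex.tendsto_self_mul_Gamma_nhds_zero.comp hhalf
  have hpow : Tendsto (fun z : ℂ => (2 : ℂ) ^ z) (nhdsWithin 0 {0}ᶜ) (nhds 1) := by
    have : Continuous fun z : ℂ => (2 : ℂ) ^ z :=
      continuous_id.const_cpow (Or.inl two_ne_zero)
    exact (this.tendsto' 0 1 (by simp)).mono_left nhdsWithin_le_nhds
  have hinv : Tendsto (fun z : ℂ => (Complex.Gamma ((n - z) / 2))⁻¹) (nhdsWithin 0 {0}ᶜ)
      (nhds (Complex.Gamma (n / 2))⁻¹) := by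
    have : Continuous fun z : ℂ => (Complex.Gamma ((n - z) / 2))⁻¹ :=
      Complex.differentiable_one_div_Gamma.continuous.comp
        (by fun_prop : Continuous fun z : ℂ => ((n : ℂ) - z) / 2)
    exact (this.tendsto' 0 _ (by simp)).mono_left nhdsWithin_le_nhds
  have hprod := (((hpow.mul_const ((Real.pi : ℂ) ^ ((n : ℂ) / 2))).mul
    (hGamma.const_mul 2)).mul hinv).comp hcoe
  have hlim : (n * volume.real (ball (0 : EuclideanSpace ℝ (Fin n)) 1) : ℝ) =
      1 * (Real.pi : ℂ) ^ ((n : ℂ) / 2) * (2 * 1) * (Complex.Gamma (n / 2))⁻¹ := by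
    have : Nonempty (Fin n) := ⟨⟨0, hn⟩⟩
    have hpi : ((√Real.pi ^ n : ℝ) : ℂ) = (Real.pi : ℂ) ^ ((n : ℂ) / 2) := by
      rw [Real.sqrt_eq_rpow, ← Real.rpow_natCast, ← Real.rpow_mul Real.pi_pos.le,
        Complex.ofReal_cpow Real.pi_pos.le]
      congr 1
      push_cast
      ring
    have hGpos : 0 < Real.Gamma ((n : ℝ) / 2 + 1) := Real.Gamma_pos_of_pos (by positivity)
    rw [measureReal_def, EuclideanSpace.volume_ball]
    simp only [ENNReal.ofReal_one, one_pow, one_mul, Fintype.card_fin]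
    rw [ENNReal.toReal_ofReal (by positivity), Complex.ofReal_mul, Complex.ofReal_div, hpi,
      ← Complex.Gamma_ofReal]
    push_cast
    rw [Complex.Gamma_add_one _ (by simpa using hn0)]
    have hG : Complex.Gamma ((n : ℂ) / 2) ≠ 0 := Complex.Gamma_ne_zero_of_re_pos (by
      rw [show (n : ℂ) / 2 = ((n / 2 : ℝ) : ℂ) by push_cast; rfl, Complex.ofReal_re]
      positivity)
    field_simp
  rw [hlim]
  refine hprod.congr fun s => ?_
  simp only [Function.comp_apply, Hfun]
  ring

theorem riesz_ofReal_eq (n : ℕ) (f : EuclideanSpace ℝ (Fin n) → ℂ) (s : ℝ)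
    (x : EuclideanSpace ℝ (Fin n)) :
    riesz n f s x = (Hfun n s)⁻¹ *
      ∫ z : EuclideanSpace ℝ (Fin n), ‖z‖ ^ (s - n) • f (x - z) := by
  rw [riesz, ← integral_sub_left_eq_self _ volume x]
  congr 2 with z
  rw [sub_sub_cancel, Complex.real_smul, Complex.ofReal_cpow (norm_nonneg z), mul_comm]
  push_cast
  rfl

theorem stmt_14 (a : ℝ) (ha : 0 < a) (n : ℕ) (hn : 0 < n) (x : EuclideanSpace ℝ (Fin n))
    (f : EuclideanSpace ℝ (Fin n) → ℂ) (hfc : Continuous f)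
    (hdecay : f =O[cocompact (EuclideanSpace ℝ (Fin n))] fun y => ‖y‖ ^ (-a)) :
    Filter.Tendsto (fun s : ℝ => riesz n f (s : ℂ) x)
      (nhdsWithin 0 (Set.Ioi 0)) (nhds (f x)) := by
  have : Nontrivial (EuclideanSpace ℝ (Fin n)) :=
    Module.nontrivial_of_finrank_pos (R := ℝ) (by simpa using hn)
  obtain ⟨C, hC⟩ := exists_norm_comp_sub_left_le_of_isBigO_cocompact ha hfc hdecay x
  have hint := tendsto_mul_integral_norm_rpow
    (volume : Measure (EuclideanSpace ℝ (Fin n))) (g := fun z => f (x - z)) (by fun_prop) ha hC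
  rw [finrank_euclideanSpace_fin, sub_zero] at hint
  have hκ : ((n * volume.real (ball (0 : EuclideanSpace ℝ (Fin n)) 1) : ℝ) : ℂ) ≠ 0 :=
    Complex.ofReal_ne_zero.2
      (mul_pos (Nat.cast_pos.2 hn) (ENNReal.toReal_pos (measure_ball_pos volume 0 one_pos).ne'
        measure_ball_lt_top.ne)).ne'
  have h := ((tendsto_mul_Hfun n hn).inv₀ hκ).mul hint
  rw [inv_mul_cancel_left₀ hκ] at h
  refine h.congr' ?_
  filter_upwards [self_mem_nhdsWithin] with s hs
  have hs0 : (s : ℂ) ≠ 0 := Complex.ofReal_ne_zero.2 (mem_Ioi.1 hs).ne'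
  rw [riesz_ofReal_eq]
  field_simp
end
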